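/- arXiv:1312.3176 — 11 statements merged into one kernel-verified Lean document; each statement's English description precedes it below -/
import Mathlib

section
/- The potential V is continuous on the whole plane, i.e. the function P ↦ ∫ Q in T, (dist P Q)⁻¹ ∂volume is continuous on E. -/
open MeasureTheory

/-- The potential of a bounded set with null frontier, for a locally integrable kernel, is
continuous. -/
theorem continuous_setIntegral_sub_of_locallyIntegrable {E : Type*} [NormedAddCommGroup E]
    [ProperSpace E] [MeasurableSpace E] [BorelSpace E]
    {μ : Measure E} [μ.IsAddLeftInvariant] [μ.IsNegInvariant] {T : Set E} {k : E → ℝ}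
    (hT : MeasurableSet T) (hbdd : Bornology.IsBounded T) (hfr : μ (frontier T) = 0)
    (hk : LocallyIntegrable k μ) (hkm : Measurable k) :
    Continuous fun P ↦ ∫ Q in T, k (P - Q) ∂μ := by
  have hsub (P : E) :
      ∫ Q in T, k (P - Q) ∂μ = ∫ z, T.indicator (fun _ ↦ k z) (P - z) ∂μ := by
    rw [← integral_indicator hT, ← integral_sub_left_eq_self _ μ P]
    refine integral_congr_ae (.of_forall fun z ↦ ?_)
    simp [Set.indicator]
  simp_rw [hsub]
  refine continuous_iff_continuousAt.2 fun P₀ ↦ ?_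
  obtain ⟨R, hR⟩ := hbdd.exists_norm_le
  set K := Metric.closedBall (0 : E) (‖P₀‖ + 1 + R)
  have hKm : MeasurableSet K := Metric.isClosed_closedBall.measurableSet
  refine continuousAt_of_dominated (bound := K.indicator fun z ↦ ‖k z‖) ?_ ?_ ?_ ?_
  · refine .of_forall fun P ↦ ?_
    exact (hkm.indicator ((measurable_const_sub P) hT)).aestronglyMeasurable
  · filter_upwards [Metric.ball_mem_nhds P₀ one_pos] with P hP
    refine .of_forall fun z ↦ ?_
    by_cases hz : P - z ∈ T
    · have hzK : z ∈ K := by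
        have h₁ : ‖P - P₀‖ < 1 := by rwa [← dist_eq_norm]
        have h₂ := hR _ hz
        have h₃ : ‖z‖ ≤ ‖P₀‖ + ‖P - P₀‖ + ‖P - z‖ := by
          calc ‖z‖ = ‖P₀ + (P - P₀) - (P - z)‖ := by congr 1; abel
            _ ≤ _ := (norm_sub_le _ _).trans (by gcongr; exact norm_add_le _ _)
        exact mem_closedBall_zero_iff.2 (by linarith)
      simp [hz, hzK]
    · simpa [hz] using Set.indicator_nonneg (fun z _ ↦ norm_nonneg (k z)) z
  · rw [integrable_indicator_iff hKm]
    exact (hk.integrableOn_isCompact (isCompact_closedBall _ _)).norm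
  · have hae : ∀ᵐ z ∂μ, P₀ - z ∉ frontier T :=
      (Measure.measurePreserving_sub_left μ P₀).quasiMeasurePreserving.ae
        (measure_eq_zero_iff_ae_notMem.1 hfr)
    filter_upwards [hae] with z hz
    have h : ContinuousAt (T.indicator fun _ ↦ k z) (P₀ - z) :=
      continuousOn_const.continuousAt_indicator hz
    exact h.comp (f := fun P ↦ P - z) (by fun_prop)

/-- In dimension at least two, `‖x‖⁻¹` is locally integrable. -/
theorem locallyIntegrable_norm_inv {E : Type*} [NormedAddCommGroup E] [NormedSpace ℝ E]
    [FiniteDimensional ℝ E] [MeasurableSpace E] [BorelSpace E]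
    {μ : Measure E} [μ.IsAddHaarMeasure] (hE : 1 < Module.finrank ℝ E) :
    LocallyIntegrable (fun x : E ↦ ‖x‖⁻¹) μ := by
  refine locallyIntegrable_of_norm_le_rpow (C := 1) (α := 1) hE.le (by exact_mod_cast hE) ?_
    measurable_norm.inv.aestronglyMeasurable
  exact .of_forall fun x ↦ by simp [Real.rpow_neg_one]

theorem potential_continuous
    (A B C : EuclideanSpace ℝ (Fin 2))
    (hABC : AffineIndependent ℝ ![A, B, C])
    (T : Set (EuclideanSpace ℝ (Fin 2)))
    (hT : T = convexHull ℝ {A, B, C})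
    (V : EuclideanSpace ℝ (Fin 2) → ℝ)
    (hV : ∀ P, V P = ∫ Q in T, (dist P Q)⁻¹ ∂volume) :
    Continuous V := by
  have hcpt : IsCompact T := by
    rw [hT]
    exact (Set.toFinite {A, B, C}).isCompact_convexHull ℝ
  have hconv : Convex ℝ T := hT ▸ convex_convexHull ℝ _
  rw [funext hV]
  simp_rw [dist_eq_norm]
  exact continuous_setIntegral_sub_of_locallyIntegrable hcpt.isClosed.measurableSet
    hcpt.isBounded (hconv.addHaar_frontier volume) (locallyIntegrable_norm_inv (by simp))
    measurable_norm.inv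
end

section
/- For every point P lying outside the triangle T (i.e. P ∉ T), the potential V is differentiable at P and its gradient is given by the absolutely convergent integral gradient V P = ∫ Q in T, (dist P Q)⁻³ • (Q − P) ∂volume. -/
open MeasureTheory

theorem hasGradientAt_inv_dist {E : Type*} [NormedAddCommGroup E] [InnerProductSpace ℝ E]
    [CompleteSpace E] {x q : E} (h : x ≠ q) :
    HasGradientAt (fun y => (dist y q)⁻¹) ((dist x q ^ 3)⁻¹ • (q - x)) x := by
  have hpos : 0 < dist x q := dist_pos.2 h
  have hsq : HasFDerivAt (fun y => ‖y - q‖ ^ 2) _ x := ((hasFDerivAt_id x).sub_const q).norm_sq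
  have hne : ‖x - q‖ ^ 2 ≠ 0 := by rw [← dist_eq_norm]; positivity
  have hinv := (hasDerivAt_inv (Real.sqrt_ne_zero'.2 (by positivity))).comp_hasFDerivAt x
    (hsq.sqrt hne)
  rw [hasGradientAt_iff_hasFDerivAt]
  have hfun : (fun y => (dist y q)⁻¹) = Inv.inv ∘ fun y => √(‖y - q‖ ^ 2) := by
    funext y
    simp [dist_eq_norm]
  rw [hfun]
  refine hinv.congr_fderiv ?_
  ext v
  simp only [id, ← dist_eq_norm, Real.sqrt_sq hpos.le]
  simp only [InnerProductSpace.toDual_apply_apply, inner_smul_left, inner_sub_left,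
    _root_.smul_apply, ContinuousLinearMap.comp_apply, innerSL_apply_apply,
    ContinuousLinearMap.id_apply, smul_eq_mul, nsmul_eq_mul, RCLike.conj_to_real]
  push_cast
  field_simp
  ring

theorem norm_inv_dist_cube_smul_sub {E : Type*} [NormedAddCommGroup E] [NormedSpace ℝ E]
    {x q : E} (h : x ≠ q) : ‖(dist x q ^ 3)⁻¹ • (q - x)‖ = (dist x q ^ 2)⁻¹ := by
  have hpos : 0 < dist x q := dist_pos.2 h
  rw [norm_smul, ← dist_eq_norm, dist_comm q x, Real.norm_of_nonneg (by positivity)]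
  field_simp

section

variable {E : Type*} [NormedAddCommGroup E] [MeasurableSpace E] [BorelSpace E]
  {μ : Measure E} [IsFiniteMeasureOnCompacts μ] {K : Set E} {P : E}

theorem IsCompact.integrableOn_inv_dist (hK : IsCompact K) (hP : P ∉ K) :
    IntegrableOn (fun Q => (dist P Q)⁻¹) K μ := by
  refine ContinuousOn.integrableOn_compact hK (ContinuousOn.inv₀ (by fun_prop) fun Q hQ => ?_)
  exact dist_ne_zero.2 fun h => hP (h ▸ hQ)

theorem IsCompact.integrableOn_inv_dist_cube_smul_sub [NormedSpace ℝ E] (hK : IsCompact K)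
    (hP : P ∉ K) : IntegrableOn (fun Q => (dist P Q ^ 3)⁻¹ • (Q - P)) K μ := by
  refine ContinuousOn.integrableOn_compact hK
    (ContinuousOn.smul (ContinuousOn.inv₀ (by fun_prop) fun Q hQ => ?_) (by fun_prop))
  exact pow_ne_zero _ (dist_ne_zero.2 fun h => hP (h ▸ hQ))

/-- The Newtonian-type potential of a compact set is differentiable off the set, and its gradient
is obtained by differentiating under the integral sign. -/
theorem IsCompact.hasGradientAt_setIntegral_inv_dist [InnerProductSpace ℝ E] [CompleteSpace E]
    (hK : IsCompact K) (hP : P ∉ K) :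
    HasGradientAt (fun x => ∫ Q in K, (dist x Q)⁻¹ ∂μ)
      (∫ Q in K, (dist P Q ^ 3)⁻¹ • (Q - P) ∂μ) P := by
  obtain ⟨ε, hε, hball⟩ := Metric.isOpen_iff.1 hK.isClosed.isOpen_compl P hP
  have hfar : ∀ x ∈ Metric.ball P (ε / 2), ∀ Q ∈ K, ε / 2 ≤ dist x Q := by
    intro x hx Q hQ
    by_contra! hlt
    refine hball (Metric.mem_ball.2 ?_) hQ
    have := dist_triangle_left Q P x
    rw [Metric.mem_ball] at hx
    linarith
  have hnotMem : ∀ x ∈ Metric.ball P (ε / 2), x ∉ K := fun x hx hxK => by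
    have := hfar x hx x hxK
    rw [dist_self] at this
    linarith
  have hnhds : Metric.ball P (ε / 2) ∈ nhds P := Metric.ball_mem_nhds P (by positivity)
  have hint := hK.integrableOn_inv_dist_cube_smul_sub (μ := μ) hP
  let L : E →L[ℝ] (E →L[ℝ] ℝ) := innerSL ℝ
  have hL : ∀ v, L v = InnerProductSpace.toDual ℝ E v := fun v => rfl
  rw [hasGradientAt_iff_hasFDerivAt, ← hL, ← L.integral_comp_comm hint]
  refine hasFDerivAt_integral_of_dominated_of_fderiv_le
    (F' := fun x Q => L ((dist x Q ^ 3)⁻¹ • (Q - x)))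
    (bound := fun _ => ((ε / 2) ^ 2)⁻¹) hnhds ?_ (hK.integrableOn_inv_dist hP)
    (L.integrable_comp hint).aestronglyMeasurable ?_
    (integrableOn_const hK.measure_lt_top.ne) ?_
  · filter_upwards [hnhds] with x hx
    exact (hK.integrableOn_inv_dist (hnotMem x hx)).aestronglyMeasurable
  · refine ae_restrict_of_forall_mem hK.measurableSet fun Q hQ x hx => ?_
    have hxQ : x ≠ Q := fun h => hnotMem x hx (h ▸ hQ)
    rw [hL, LinearIsometryEquiv.norm_map, norm_inv_dist_cube_smul_sub hxQ]
    have := hfar x hx Q hQ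
    gcongr
  · refine ae_restrict_of_forall_mem hK.measurableSet fun Q hQ x hx => ?_
    have hxQ : x ≠ Q := fun h => hnotMem x hx (h ▸ hQ)
    rw [hL]
    exact (hasGradientAt_inv_dist hxQ).hasFDerivAt

end

theorem potential_differentiable_exterior
    (A B C : EuclideanSpace ℝ (Fin 2))
    (hABC : AffineIndependent ℝ ![A, B, C])
    (T : Set (EuclideanSpace ℝ (Fin 2)))
    (hT : T = convexHull ℝ {A, B, C})
    (V : EuclideanSpace ℝ (Fin 2) → ℝ)
    (hV : ∀ P, V P = ∫ Q in T, (dist P Q)⁻¹ ∂volume)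
    (P : EuclideanSpace ℝ (Fin 2)) (hP : P ∉ T) :
    DifferentiableAt ℝ V P ∧
    IntegrableOn (fun Q => (dist P Q ^ 3)⁻¹ • (Q - P)) T volume ∧
    gradient V P = ∫ Q in T, (dist P Q ^ 3)⁻¹ • (Q - P) ∂volume := by
  have hK : IsCompact T := hT ▸ (Set.toFinite {A, B, C}).isCompact_convexHull ℝ
  have hgrad : HasGradientAt V (∫ Q in T, (dist P Q ^ 3)⁻¹ • (Q - P) ∂volume) P := by
    rw [funext hV]
    exact hK.hasGradientAt_setIntegral_inv_dist hP
  exact ⟨hgrad.differentiableAt, hK.integrableOn_inv_dist_cube_smul_sub hP, hgrad.gradient⟩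
end

section
/- For every point P in the interior of T and every ε > 0 such that the closed ball of radius ε around P is contained in the interior of T, the potential V is differentiable at P and its gradient is given by the truncated integral gradient V P = ∫ Q in T \ Metric.ball P ε, (dist P Q)⁻³ • (Q − P) ∂volume. (In particular this truncated integral is independent of the choice of such ε.) -/
open MeasureTheory

section InvDist

variable {E : Type*} [NormedAddCommGroup E] [InnerProductSpace ℝ E]

theorem hasFDerivAt_inv_dist {X Q : E} (h : X ≠ Q) :
    HasFDerivAt (fun x => (dist x Q)⁻¹) (innerSL ℝ ((dist X Q ^ 3)⁻¹ • (Q - X))) X := by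
  have hd : 0 < dist X Q := dist_pos.2 h
  have hsq : HasFDerivAt (fun x : E => ‖x - Q‖ ^ 2)
      (2 • (innerSL ℝ (X - Q)).comp (ContinuousLinearMap.id ℝ E)) X :=
    ((hasFDerivAt_id X).sub_const Q).norm_sq
  have hdist : HasFDerivAt (fun x : E => dist x Q) ((dist X Q)⁻¹ • innerSL ℝ (X - Q)) X := by
    have hne : ‖X - Q‖ ^ 2 ≠ 0 := by rw [← dist_eq_norm]; positivity
    have := hsq.sqrt hne
    simp only [Real.sqrt_sq (norm_nonneg _)] at this
    simp only [← dist_eq_norm] at this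
    refine this.congr_fderiv ?_
    ext v
    simp
    field_simp
  refine ((hasDerivAt_inv hd.ne').comp_hasFDerivAt X hdist).congr_fderiv ?_
  ext v
  rw [← neg_sub X Q]
  simp [-neg_sub]
  field_simp

theorem norm_inv_dist_pow_three_smul {X Q : E} :
    ‖(dist X Q ^ 3)⁻¹ • (Q - X)‖ = (dist X Q ^ 2)⁻¹ := by
  rcases eq_or_ne X Q with rfl | h
  · simp
  · have hd : 0 < dist X Q := dist_pos.2 h
    rw [norm_smul, ← dist_eq_norm, dist_comm Q X, Real.norm_of_nonneg (by positivity)]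
    field_simp

variable [MeasurableSpace E] [BorelSpace E] [FiniteDimensional ℝ E]

/-- Away from its singularity, the kernel `(dist X Q)⁻¹` may be differentiated under
the integral sign. -/
theorem hasGradientAt_setIntegral_inv_dist {μ : Measure E} {S : Set E} {P : E} {ε : ℝ}
    (hε : 0 < ε) (hS : MeasurableSet S) (hμS : μ S ≠ ⊤) (hSP : ∀ Q ∈ S, ε ≤ dist P Q) :
    HasGradientAt (fun X => ∫ Q in S, (dist X Q)⁻¹ ∂μ)
      (∫ Q in S, (dist P Q ^ 3)⁻¹ • (Q - P) ∂μ) P := by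
  have hfin : IsFiniteMeasure (μ.restrict S) := ⟨by simpa using hμS.lt_top⟩
  have hmeas : ∀ X : E, Measurable fun Q : E => (dist X Q ^ 3)⁻¹ • (Q - X) := fun X => by fun_prop
  have hfar : ∀ X ∈ Metric.ball P (ε / 2), ∀ Q ∈ S, ε / 2 ≤ dist X Q := fun X hX Q hQ => by
    have h₁ := dist_triangle_left P Q X
    have h₂ := hSP Q hQ
    rw [Metric.mem_ball] at hX
    linarith
  have hint : Integrable (fun Q => (dist P Q ^ 3)⁻¹ • (Q - P)) (μ.restrict S) := by
    refine Integrable.of_bound (hmeas P).aestronglyMeasurable ((ε ^ 2)⁻¹) ?_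
    filter_upwards [ae_restrict_mem hS] with Q hQ
    rw [norm_inv_dist_pow_three_smul]
    gcongr
    exact hSP Q hQ
  have key := hasFDerivAt_integral_of_dominated_of_fderiv_le (𝕜 := ℝ) (μ := μ.restrict S)
    (F := fun X Q => (dist X Q)⁻¹)
    (F' := fun X Q => innerSL ℝ ((dist X Q ^ 3)⁻¹ • (Q - X)))
    (bound := fun _ => ((ε / 2) ^ 2)⁻¹) (x₀ := P)
    (Metric.ball_mem_nhds P (half_pos hε))
    (.of_forall fun X => Measurable.aestronglyMeasurable (by fun_prop))
    (by
      refine Integrable.of_bound (Measurable.aestronglyMeasurable (by fun_prop)) ε⁻¹ ?_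
      filter_upwards [ae_restrict_mem hS] with Q hQ
      rw [Real.norm_of_nonneg (by positivity)]
      gcongr
      exact hSP Q hQ)
    ((innerSL ℝ).continuous.comp_aestronglyMeasurable (hmeas P).aestronglyMeasurable)
    (by
      filter_upwards [ae_restrict_mem hS] with Q hQ X hX
      rw [innerSL_apply_norm, norm_inv_dist_pow_three_smul]
      gcongr
      exact hfar X hX Q hQ)
    (integrable_const _)
    (by
      filter_upwards [ae_restrict_mem hS] with Q hQ X hX
      exact hasFDerivAt_inv_dist (dist_pos.1 ((half_pos hε).trans_le (hfar X hX Q hQ))))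
  rw [hasGradientAt_iff_hasFDerivAt]
  refine key.congr_fderiv ?_
  exact (innerSL ℝ).integral_comp_comm hint

end InvDist

section Plane

/-- The plane with its Euclidean norm. -/
abbrev EuclideanPlane := EuclideanSpace ℝ (Fin 2)

theorem integrableOn_inv_dist_ball (X : EuclideanPlane) (r : ℝ) :
    IntegrableOn (fun Q => (dist X Q)⁻¹) (Metric.ball X r) := by
  have h₀ : IntegrableOn (fun x : EuclideanPlane => ‖x‖⁻¹) (Metric.ball 0 r) := by
    rw [integrableOn_fun_norm_addHaar volume (f := fun y => y⁻¹)]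
    refine (integrableOn_const (C := (1 : ℝ)) (by simp)).congr_fun (fun y hy => ?_)
      measurableSet_Ioo
    have : y ≠ 0 := hy.1.ne'
    simp [this]
  have := (measurePreserving_sub_right (volume : Measure EuclideanPlane) 
    X).integrableOn_comp_preimage
    (measurableEmbedding_subRight X) (f := fun x : EuclideanPlane => ‖x‖⁻¹) (s := Metric.ball 0 r)
  have h₁ := this.2 h₀
  have hpre : (fun x : EuclideanPlane => x - X) ⁻¹' Metric.ball 0 r = Metric.ball X r := by
    ext; simp [dist_eq_norm]
  rw [hpre] at h₁
  simpa [Function.comp_def, dist_comm X, dist_eq_norm] using h₁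

theorem integrableOn_inv_dist {S : Set EuclideanPlane} (hS : Bornology.IsBounded S)
    (X : EuclideanPlane) :
    IntegrableOn (fun Q => (dist X Q)⁻¹) S := by
  obtain ⟨r, hr⟩ := hS.subset_ball X
  exact (integrableOn_inv_dist_ball X r).mono_set hr

theorem volume_real_ball_fin_two (X : EuclideanPlane) {r : ℝ} (hr : 0 ≤ r) :
    volume.real (Metric.ball X r) = r ^ 2 * Real.pi := by
  simp [measureReal_def, hr, Real.pi_nonneg]

theorem abs_potential_ball_sub_le {P X : EuclideanPlane} {ε : ℝ} (hε : 0 < ε)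
    (hX : dist X P ≤ ε / 2) :
    |(∫ Q in Metric.ball P ε, (dist X Q)⁻¹) - ∫ Q in Metric.ball P ε, (dist P Q)⁻¹| ≤
      8 * Real.pi / ε * dist X P ^ 2 := by
  set r := dist X P with hr
  have hr0 : 0 ≤ r := dist_nonneg
  set P' := P + (P - X) with hP'
  have hPP' : dist P' P = r := by rw [hr, dist_comm X P, dist_eq_norm, dist_eq_norm]; simp [hP']
  have htrans : ∫ Q in Metric.ball P ε, (dist X Q)⁻¹ = ∫ Q in Metric.ball P' ε, (dist P Q)⁻¹ := by
    rw [← (measurePreserving_add_right (volume : Measure EuclideanPlane)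
      (P - X)).setIntegral_preimage_emb (measurableEmbedding_addRight _)
      (fun Q => (dist P Q)⁻¹) (Metric.ball P' ε)]
    have hpre : (fun Q : EuclideanPlane => Q + (P - X)) ⁻¹' Metric.ball P' ε = Metric.ball P ε := by
      ext; simp [hP']
    rw [hpre]
    congr! 3 with Q
    rw [dist_eq_norm, dist_eq_norm]
    congr 1
    abel
  let k : EuclideanPlane → ℝ := fun Q => (dist P Q)⁻¹ - ε⁻¹
  have hk : ∀ Y : EuclideanPlane, IntegrableOn k (Metric.ball Y ε) := fun Y =>
    (integrableOn_inv_dist Metric.isBounded_ball P).sub (integrableOn_const (by finiteness))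
  have hsub : ∀ Y : EuclideanPlane, ∫ Q in Metric.ball Y ε, (dist P Q)⁻¹ =
      (∫ Q in Metric.ball Y ε, k Q) + ε ^ 2 * Real.pi * ε⁻¹ := fun Y => by
    rw [integral_sub (integrableOn_inv_dist Metric.isBounded_ball P)
      (integrableOn_const (by finiteness)), setIntegral_const, volume_real_ball_fin_two Y hε.le,
      smul_eq_mul, sub_add_cancel]
  set N := Metric.ball P (ε + r) \ Metric.ball P (ε - r) with hN
  have hNmeas : MeasurableSet N := measurableSet_ball.diff measurableSet_ball
  have hNfin : volume N ≠ ⊤ := measure_ne_top_of_subset Set.sdiff_subset measure_ball_lt_top.ne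
  have hNvol : volume.real N = 4 * ε * r * Real.pi := by
    rw [hN, measureReal_sdiff (Metric.ball_subset_ball (by linarith)) measurableSet_ball,
      volume_real_ball_fin_two P (by linarith), volume_real_ball_fin_two P (by linarith)]
    ring
  have hkN : ∀ Q ∈ N, |k Q| ≤ 2 * r / ε ^ 2 := fun Q hQ => by
    obtain ⟨h₁, h₂⟩ := hQ
    rw [Metric.mem_ball, dist_comm] at h₁ h₂
    have hd : ε / 2 ≤ dist P Q := by linarith
    have hd0 : 0 < dist P Q := by linarith
    have hkQ : k Q = (ε - dist P Q) / (dist P Q * ε) := by simp only [k]; field_simp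
    rw [hkQ, abs_div, abs_of_pos (mul_pos hd0 hε)]
    calc |ε - dist P Q| / (dist P Q * ε) ≤ r / (ε / 2 * ε) := by
          gcongr
          rw [abs_le]
          constructor <;> linarith
      _ = 2 * r / ε ^ 2 := by field_simp
  rw [htrans, hsub P', hsub P, add_sub_add_right_eq_sub,
    ← integral_indicator measurableSet_ball, ← integral_indicator measurableSet_ball,
    ← integral_sub ((hk P').integrable_indicator measurableSet_ball)
      ((hk P).integrable_indicator measurableSet_ball), ← Real.norm_eq_abs]
  calc _ ≤ ∫ Q, N.indicator (fun _ => 2 * r / ε ^ 2) Q := by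
        refine norm_integral_le_of_norm_le ((integrable_indicator_iff hNmeas).2
          (integrableOn_const hNfin)) (.of_forall fun Q => ?_)
        by_cases hQN : Q ∈ N
        · have := hkN Q hQN
          have h0 : 0 ≤ 2 * r / ε ^ 2 := by positivity
          rw [Set.indicator_of_mem hQN, Real.norm_eq_abs]
          by_cases h₁ : Q ∈ Metric.ball P' ε <;> by_cases h₂ : Q ∈ Metric.ball P ε <;>
            simp only [h₁, h₂, Set.indicator_of_mem, Set.indicator_of_notMem, not_false_eq_true,
              sub_self, sub_zero, zero_sub, abs_neg, abs_zero] <;> assumption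
        · have hiff : Q ∈ Metric.ball P' ε ↔ Q ∈ Metric.ball P ε := by
            have h₁ := dist_triangle Q P' P
            have h₂ := dist_triangle_right Q P' P
            have h₃ : dist Q P < ε + r → dist Q P < ε - r := by
              simpa [hN, lt_sub_iff_add_lt] using hQN
            simp only [Metric.mem_ball]
            constructor
            · intro h
              linarith [h₃ (by linarith)]
            · intro h
              linarith [h₃ (by linarith)]
          rw [Set.indicator_of_notMem hQN]
          by_cases h₂ : Q ∈ Metric.ball P ε
          · simp only [Set.indicator_of_mem h₂, Set.indicator_of_mem (hiff.2 h₂), sub_self,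
              norm_zero, le_refl]
          · simp only [Set.indicator_of_notMem h₂, Set.indicator_of_notMem (mt hiff.1 h₂),
              sub_self, norm_zero, le_refl]
    _ = 8 * Real.pi / ε * r ^ 2 := by
        rw [integral_indicator hNmeas, setIntegral_const, hNvol, smul_eq_mul]
        field_simp
        ring

theorem hasFDerivAt_potential_ball (P : EuclideanPlane) {ε : ℝ} (hε : 0 < ε) :
    HasFDerivAt (fun X => ∫ Q in Metric.ball P ε, (dist X Q)⁻¹) (0 : EuclideanPlane →L[ℝ] ℝ) P := by
  have hO : (fun X : EuclideanPlane => (∫ Q in Metric.ball P ε, (dist X Q)⁻¹) -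
      ∫ Q in Metric.ball P ε, (dist P Q)⁻¹) =O[nhds P] fun X => ‖X - P‖ ^ 2 := by
    refine Asymptotics.IsBigO.of_bound (8 * Real.pi / ε) ?_
    filter_upwards [Metric.closedBall_mem_nhds P (half_pos hε)] with X hX
    simpa [dist_eq_norm] using abs_potential_ball_sub_le hε hX
  simpa using (hO.hasFDerivAt (𝕜 := ℝ) one_lt_two).add_const
    (∫ Q in Metric.ball P ε, (dist P Q)⁻¹)

theorem hasGradientAt_potential {S : Set EuclideanPlane} (hS : MeasurableSet S)
    (hb : Bornology.IsBounded S) {P : EuclideanPlane} {ε : ℝ} (hε : 0 < ε)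
    (hball : Metric.ball P ε ⊆ S) :
    HasGradientAt (fun X => ∫ Q in S, (dist X Q)⁻¹)
      (∫ Q in S \ Metric.ball P ε, (dist P Q ^ 3)⁻¹ • (Q - P)) P := by
  have hfar := hasGradientAt_setIntegral_inv_dist (μ := volume) (P := P) hε
    (hS.diff measurableSet_ball) (hb.subset Set.sdiff_subset).measure_lt_top.ne
    (fun Q hQ => not_lt.1 fun h => hQ.2 (Metric.mem_ball'.2 h))
  have hsum := (hasFDerivAt_potential_ball P hε).add hfar.hasFDerivAt
  rw [zero_add] at hsum
  refine HasFDerivAt.congr_of_eventuallyEq hsum (.of_forall fun X => ?_)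
  have := integral_inter_add_sdiff (μ := volume) (measurableSet_ball (x := P) (ε := ε))
    (integrableOn_inv_dist hb X)
  rw [Set.inter_eq_right.2 hball] at this
  exact this.symm

end Plane

theorem potential_differentiable_interior
    (A B C : EuclideanSpace ℝ (Fin 2))
    (hABC : AffineIndependent ℝ ![A, B, C])
    (T : Set (EuclideanSpace ℝ (Fin 2)))
    (hT : T = convexHull ℝ {A, B, C})
    (V : EuclideanSpace ℝ (Fin 2) → ℝ)
    (hV : ∀ P, V P = ∫ Q in T, (dist P Q)⁻¹ ∂volume)
    (P : EuclideanSpace ℝ (Fin 2)) (hP : P ∈ interior T)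
    (ε : ℝ) (hε : 0 < ε) (hball : Metric.closedBall P ε ⊆ interior T) :
    DifferentiableAt ℝ V P ∧
    gradient V P = ∫ Q in T \ Metric.ball P ε, (dist P Q ^ 3)⁻¹ • (Q - P) ∂volume := by
  have hcompact : IsCompact T := by
    rw [hT]
    exact (Set.toFinite {A, B, C}).isCompact_convexHull ℝ
  have h := hasGradientAt_potential hcompact.measurableSet hcompact.isBounded hε
    (Metric.ball_subset_closedBall.trans (hball.trans interior_subset))
  rw [← funext hV] at h
  exact ⟨h.differentiableAt, h.gradient⟩
end

section
/- The potential V attains its global maximum at some point in the interior of T, and at every such maximum point the gradient vanishes: there exists P ∈ interior T such that V Q ≤ V P for every point Q of the plane and gradient V P = 0. -/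
open MeasureTheory

namespace TrianglePotential

open Set Filter Topology
open scoped Pointwise

local notation "E₂" => EuclideanSpace ℝ (Fin 2)

/-- The similarity of ratio `r` which sends `c` to `a`. -/
def similarity (a c : E₂) (r : ℝ) (x : E₂) : E₂ := a + r • (x - c)

lemma continuous_similarity (a c : E₂) (r : ℝ) : Continuous (similarity a c r) := by
  unfold similarity
  fun_prop

lemma similarity_image_eq (a c : E₂) (r : ℝ) (S : Set E₂) :
    similarity a c r '' S = (fun y => (a - r • c) + y) '' (r • S) := by
  rw [← image_smul, image_image]
  congr 1
  ext1 x
  rw [similarity, smul_sub]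
  abel

lemma measurableSet_similarity_image (a c : E₂) (r : ℝ) {S : Set E₂} (hS : MeasurableSet S) :
    MeasurableSet (similarity a c r '' S) := by
  rw [similarity_image_eq]
  exact (MeasurableEquiv.addLeft (a - r • c)).measurableSet_image.2 (hS.const_smul₀ r)

lemma setIntegral_similarity_image (a c : E₂) {r : ℝ} (hr : 0 < r) (S : Set E₂) (f : E₂ → ℝ) :
    ∫ y in similarity a c r '' S, f y = r ^ 2 * ∫ x in S, f (similarity a c r x) := by
  have h1 := (measurePreserving_add_left (volume : Measure E₂) (a - r • c)).setIntegral_image_emb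
    (MeasurableEquiv.addLeft (a - r • c)).measurableEmbedding f (r • S)
  have h2 := Measure.setIntegral_comp_smul_of_pos (volume : Measure E₂)
    (fun y => f ((a - r • c) + y)) S hr
  have h3 : ∀ x, f (similarity a c r x) = f ((a - r • c) + r • x) := fun x => by
    rw [similarity, smul_sub]
    congr 1
    abel
  rw [similarity_image_eq, h1]
  simp only [h3, h2, finrank_euclideanSpace, Fintype.card_fin, smul_eq_mul]
  field_simp

lemma integrable_indicator_inv_norm (R : ℝ) :
    Integrable (fun z : E₂ => (Iic R).indicator (fun y : ℝ => y⁻¹) ‖z‖) := by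
  rw [integrable_fun_norm_addHaar volume (f := (Iic R).indicator (fun y : ℝ => y⁻¹))]
  have h : IntegrableOn ((Iic R).indicator fun _ : ℝ => (1 : ℝ)) (Ioi 0) := by
    rw [IntegrableOn, integrable_indicator_iff measurableSet_Iic, IntegrableOn,
      Measure.restrict_restrict measurableSet_Iic, inter_comm, Ioi_inter_Iic]
    exact integrable_const 1
  refine h.congr_fun (fun y hy => ?_) measurableSet_Ioi
  have hy' : y ≠ 0 := (mem_Ioi.1 hy).ne'
  by_cases hR : y ∈ Iic R <;> simp [hR, hy']

lemma integrableOn_inv_dist (P : E₂) {S : Set E₂} (hS : Bornology.IsBounded S)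
    (hm : MeasurableSet S) : IntegrableOn (fun Q => (dist P Q)⁻¹) S := by
  obtain ⟨R, hR⟩ := hS.subset_closedBall P
  have h := ((integrable_indicator_inv_norm R).comp_sub_left P).integrableOn (s := S)
  refine h.congr_fun (fun Q hQ => ?_) hm
  have hQ' : ‖P - Q‖ ≤ R := by
    have := hR hQ
    rwa [Metric.mem_closedBall, dist_comm, dist_eq_norm] at this
  simp [hQ', dist_eq_norm]

/-- The Newtonian potential (with kernel the inverse distance) of a planar set. -/
noncomputable def potential (S : Set E₂) (P : E₂) : ℝ := ∫ Q in S, (dist P Q)⁻¹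

lemma potential_eq (S : Set E₂) (hm : MeasurableSet S) (P : E₂) :
    potential S P = ∫ z, S.indicator (fun _ => ‖z‖⁻¹) (P + z) := by
  rw [potential, ← integral_indicator hm,
    ← integral_add_left_eq_self (S.indicator fun Q => (dist P Q)⁻¹) P]
  refine integral_congr_ae (.of_forall fun z => ?_)
  by_cases h : P + z ∈ S <;> simp [h]

lemma continuous_potential {S : Set E₂} (hc : Convex ℝ S) (hm : MeasurableSet S)
    (hb : Bornology.IsBounded S) : Continuous (potential S) := by
  rw [continuous_iff_continuousAt]
  intro P
  rw [funext (potential_eq S hm)]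
  obtain ⟨R, hR⟩ := hb.subset_closedBall P
  refine continuousAt_of_dominated (.of_forall fun P' => ?_) ?_
    (integrable_indicator_inv_norm (R + 1)) ?_
  · have : (fun z => S.indicator (fun _ => ‖z‖⁻¹) (P' + z))
        = ((fun z => P' + z) ⁻¹' S).indicator (fun z : E₂ => ‖z‖⁻¹) := rfl
    rw [this]
    refine (Measurable.indicator (by fun_prop) ?_).aestronglyMeasurable
    exact (measurable_const_add P') hm
  · filter_upwards [Metric.ball_mem_nhds P one_pos] with P' hP'
    refine .of_forall fun z => ?_
    by_cases h : P' + z ∈ S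
    · have h1 : ‖P' + z - P‖ ≤ R := by simpa [dist_eq_norm] using hR h
      have h2 : ‖P' - P‖ < 1 := by simpa [dist_eq_norm] using hP'
      have h3 : ‖z‖ ≤ R + 1 := by
        have := norm_sub_le (P' + z - P) (P' - P)
        rw [show P' + z - P - (P' - P) = z by abel] at this
        linarith
      simp [h, h3]
    · rw [indicator_of_notMem h, norm_zero]
      rw [indicator_apply]
      split_ifs <;> positivity
  · have h0 : volume ((fun z => P + z) ⁻¹' frontier S) = 0 := by
      rw [measure_preimage_add]
      exact hc.addHaar_frontier volume
    filter_upwards [compl_mem_ae_iff.2 h0] with z hz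
    have hz' : P + z ∉ frontier S := hz
    have hcont : ContinuousAt (fun x : E₂ => x + z) P := by fun_prop
    rw [frontier, Set.mem_sdiff, not_and_not_right] at hz'
    by_cases h : P + z ∈ closure S
    · have : ∀ᶠ x in 𝓝 P, x + z ∈ S :=
        hcont (mem_interior_iff_mem_nhds.1 (hz' h))
      refine (continuousAt_const (y := ‖z‖⁻¹)).congr ?_
      filter_upwards [this] with x hx
      simp [hx]
    · have : ∀ᶠ x in 𝓝 P, x + z ∈ (closure S)ᶜ :=
        hcont (isClosed_closure.isOpen_compl.mem_nhds h)
      refine (continuousAt_const (y := (0 : ℝ))).congr ?_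
      filter_upwards [this] with x hx
      have : x + z ∉ S := fun h' => hx (subset_closure h')
      simp [this]

lemma exists_potential_le_of_convex {S : Set E₂} (hc : Convex ℝ S) (hS : IsCompact S)
    (hne : S.Nonempty) (P : E₂) : ∃ P' ∈ S, potential S P ≤ potential S P' := by
  obtain ⟨P', hP', hmin⟩ := exists_norm_eq_iInf_of_complete_convex hne hS.isComplete hc P
  refine ⟨P', hP', ?_⟩
  rw [norm_eq_iInf_iff_real_inner_le_zero hc hP'] at hmin
  refine setIntegral_mono_on_ae (integrableOn_inv_dist P hS.isBounded hS.measurableSet)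
    (integrableOn_inv_dist P' hS.isBounded hS.measurableSet) hS.measurableSet ?_
  have h0 : ∀ᵐ Q : E₂, Q ≠ P' := compl_mem_ae_iff.2 (measure_singleton P')
  filter_upwards [h0] with Q hne hQ
  have hpos : 0 < dist P' Q := dist_pos.2 hne.symm
  have h1 := hmin Q hQ
  refine inv_anti₀ hpos ?_
  rw [dist_eq_norm, dist_eq_norm]
  refine le_of_sq_le_sq ?_ (norm_nonneg _)
  have h2 : P - Q = (P - P') - (Q - P') := by abel
  rw [h2, norm_sub_sq_real (P - P'), norm_sub_rev P' Q]
  nlinarith [sq_nonneg ‖P - P'‖]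

lemma exists_forall_potential_le {S : Set E₂} (hc : Convex ℝ S) (hS : IsCompact S)
    (hne : S.Nonempty) : ∃ P ∈ S, ∀ Q, potential S Q ≤ potential S P := by
  obtain ⟨P, hP, hmax⟩ := hS.exists_isMaxOn hne
    (continuous_potential hc hS.measurableSet hS.isBounded).continuousOn
  refine ⟨P, hP, fun Q => ?_⟩
  obtain ⟨Q', hQ', h⟩ := exists_potential_le_of_convex hc hS hne Q
  exact h.trans (hmax hQ')

lemma coord_similarity (b : AffineBasis (Fin 3) ℝ E₂) (l : Fin 3) (a c : E₂) (r : ℝ) (x : E₂) :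
    b.coord l (similarity a c r x) = b.coord l a + r * (b.coord l x - b.coord l c) := by
  have h := (b.coord l).map_vadd a (r • (x - c))
  rw [vadd_eq_add, vadd_eq_add, map_smul, ← vsub_eq_sub x c, AffineMap.linearMap_vsub] at h
  rw [similarity, add_comm, ← vsub_eq_sub x c, h]
  simp [add_comm]

/-- A maximum point of the potential of a triangle `T` does not lie on the side opposite to the
vertex `b i`. The point `P` on that side is moved slightly towards `b i`; the loss coming from the
homothetic copy of `T` with centre `b i` is beaten by the gain from many small copies of `T` lined
up along the side. -/
lemma coord_ne_zero_of_forall_potential_le (b : AffineBasis (Fin 3) ℝ E₂) {P : E₂} {i j k : Fin 3}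
    (hij : i ≠ j) (hik : i ≠ k) (hjk : j ≠ k) (hjP : 1 / 2 ≤ b.coord j P) (hkP : 0 ≤ b.coord k P)
    (hP : ∀ Q, potential (convexHull ℝ (range b)) Q ≤ potential (convexHull ℝ (range b)) P) :
    b.coord i P ≠ 0 := by
  intro hiP
  have hsum : ∀ x, b.coord i x + b.coord j x + b.coord k x = 1 := fun x => by
    have h := b.sum_coord_apply_eq_one x
    rw [Fin.sum_univ_three] at h
    fin_cases i <;> fin_cases j <;> fin_cases k <;> simp at hij hik hjk ⊢ <;> linarith
  have hforall : ∀ p : Fin 3 → Prop, (∀ l, p l) ↔ p i ∧ p j ∧ p k := fun p => by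
    rw [Fin.forall_fin_succ, Fin.forall_fin_two]
    fin_cases i <;> fin_cases j <;> fin_cases k <;> simp at hij hik hjk ⊢ <;> tauto
  set T := convexHull ℝ (range b) with hT
  have hTc : IsCompact T := (finite_range b).isCompact_convexHull (𝕜 := ℝ)
  have hTm := hTc.measurableSet
  have hmemT : ∀ x, x ∈ T ↔ 0 ≤ b.coord i x ∧ 0 ≤ b.coord j x ∧ 0 ≤ b.coord k x := fun x => by
    rw [hT, AffineBasis.convexHull_eq_nonneg_coord, mem_ofPred_eq, hforall]
  have hmemI : ∀ x, x ∈ interior T ↔ 0 < b.coord i x ∧ 0 < b.coord j x ∧ 0 < b.coord k x :=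
    fun x => by rw [hT, b.interior_convexHull, mem_ofPred_eq, hforall]
  have hPT : P ∈ T := (hmemT P).2 ⟨hiP.ge, by linarith, hkP⟩
  have hvert : ∀ l, b l ∈ T := fun l => subset_convexHull ℝ _ (mem_range_self l)
  set D := Metric.diam T + 1 with hD
  have hD0 : 0 < D := by positivity
  have hdist : ∀ x ∈ T, ∀ y ∈ T, ‖x - y‖ ≤ D := fun x hx y hy => by
    have := Metric.dist_le_diam_of_mem hTc.isBounded hx hy
    rw [dist_eq_norm] at this
    linarith
  set v := volume.real (interior T) with hv
  have hfin : volume (interior T) ≠ ⊤ :=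
    ((measure_mono interior_subset).trans_lt hTc.measure_lt_top).ne
  have hv0 : 0 < v := by
    refine ENNReal.toReal_pos ?_ hfin
    refine (isOpen_interior.measure_pos volume ?_).ne'
    exact ⟨_, b.centroid_mem_interior_convexHull⟩
  suffices key : ∀ M : ℕ, 0 < M →
      ∑ m ∈ Finset.range M, v / ((m + 2) * D) ≤ potential T P by
    have hub : ∀ M : ℕ, 0 < M → ∑ m ∈ Finset.range (M + 1), 1 / ((m : ℝ) + 1)
        ≤ potential T P * D / v + 1 := fun M hM => by
      rw [Finset.sum_range_succ']
      have h := mul_le_mul_of_nonneg_right (key M hM) (div_nonneg hD0.le hv0.le)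
      rw [Finset.sum_mul, ← mul_div_assoc] at h
      have h' : ∀ m ∈ Finset.range M, v / (((m : ℝ) + 2) * D) * (D / v)
          = 1 / (((m + 1 : ℕ) : ℝ) + 1) := fun m _ => by
        push_cast
        field_simp
        ring
      rw [Finset.sum_congr rfl h'] at h
      norm_num at h ⊢
      exact h
    obtain ⟨M, hM, hM'⟩ := ((Real.tendsto_sum_range_one_div_nat_succ_atTop.comp
      (tendsto_add_atTop_nat 1)).eventually_gt_atTop (potential T P * D / v + 1) |>.and
      (eventually_gt_atTop 0)).exists
    exact (hub M hM').not_gt hM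
  intro M hM
  have hM' : (1 : ℝ) ≤ M := by exact_mod_cast hM
  set t : ℝ := 1 / (2 * M) with ht
  have ht0 : 0 < t := by positivity
  have htM : t * M = 1 / 2 := by rw [ht]; field_simp
  have ht1 : t ≤ 1 / 2 := by nlinarith
  set P' := similarity P P t (b i) with hP'
  set S := similarity P' P (1 - t) '' T with hS
  set X : ℕ → E₂ := fun m => similarity P (b j) (m * t) (b k) with hX
  set R : ℕ → Set E₂ := fun m => similarity (X m) (b j) t '' interior T with hR
  have hcS : ∀ l x, b.coord l (similarity P' P (1 - t) x)
      = t * b.coord l (b i) + (1 - t) * b.coord l x := fun l x => by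
    rw [coord_similarity, hP', coord_similarity]
    ring
  have hcRi : ∀ m x, b.coord i (similarity (X m) (b j) t x) = t * b.coord i x := fun m x => by
    simp [hX, coord_similarity, b.coord_apply, hij, hik, hiP]
  have hcRj : ∀ m x, b.coord j (similarity (X m) (b j) t x)
      = b.coord j P - (m + 1) * t + t * b.coord j x := fun m x => by
    simp only [hX, coord_similarity, b.coord_apply, if_true, if_neg hjk]
    ring
  have hcRk : ∀ m x, b.coord k (similarity (X m) (b j) t x)
      = b.coord k P + m * t + t * b.coord k x := fun m x => by
    simp only [hX, coord_similarity, b.coord_apply, if_true, if_neg hjk.symm]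
    ring
  have hST : S ⊆ T := by
    rintro _ ⟨x, hx, rfl⟩
    rw [hmemT] at hx ⊢
    rw [hcS i, hcS j, hcS k]
    simp only [b.coord_apply, if_true, if_neg hij.symm, if_neg hik.symm]
    have h1 : 0 ≤ 1 - t := by linarith
    exact ⟨by nlinarith [mul_nonneg h1 hx.1], by nlinarith [mul_nonneg h1 hx.2.1],
      by nlinarith [mul_nonneg h1 hx.2.2]⟩
  have hSi : ∀ x ∈ S, t ≤ b.coord i x := by
    rintro _ ⟨x, hx, rfl⟩
    rw [hcS i, b.coord_apply_eq]
    nlinarith [((hmemT x).1 hx).1]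
  have hRT : ∀ m ∈ Finset.range M, R m ⊆ T := by
    rintro m hm _ ⟨x, hx, rfl⟩
    rw [hmemI] at hx
    have hmM : ((m : ℝ) + 1) * t ≤ 1 / 2 := by
      have : (m : ℝ) + 1 ≤ M := by exact_mod_cast Finset.mem_range.1 hm
      nlinarith
    rw [hmemT, hcRi, hcRj, hcRk]
    have hm0 : (0 : ℝ) ≤ m * t := by positivity
    exact ⟨by nlinarith [mul_pos ht0 hx.1], by nlinarith [mul_pos ht0 hx.2.1],
      by nlinarith [mul_pos ht0 hx.2.2]⟩
  have hRi : ∀ m, ∀ x ∈ R m, b.coord i x < t := by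
    rintro m _ ⟨x, hx, rfl⟩
    rw [hmemI] at hx
    rw [hcRi]
    nlinarith [hsum x]
  have hRk : ∀ m, ∀ x ∈ R m, b.coord k x - b.coord k P ∈ Ioo (m * t) ((m + 1) * t) := by
    rintro m _ ⟨x, hx, rfl⟩
    rw [hmemI] at hx
    rw [hcRk]
    constructor <;> nlinarith [hsum x, mul_pos ht0 hx.2.2]
  have hRdisj : ∀ m n : ℕ, m < n → Disjoint (R m) (R n) := fun m n hmn => by
    rw [Set.disjoint_left]
    intro x hm hn
    have h1 := (hRk m x hm).2
    have h2 := (hRk n x hn).1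
    have h3 : (m : ℝ) + 1 ≤ n := by exact_mod_cast hmn
    nlinarith
  have hSint : ∫ Q in S, (dist P' Q)⁻¹ = (1 - t) * potential T P := by
    rw [hS, setIntegral_similarity_image _ _ (by linarith), potential, sq, mul_assoc,
      ← integral_const_mul]
    congr 2
    ext1 x
    rw [dist_eq_norm, dist_eq_norm, similarity, sub_add_cancel_left, norm_neg, norm_smul,
      Real.norm_of_nonneg (by linarith), mul_inv, norm_sub_rev x P,
      mul_inv_cancel_left₀ (by linarith)]
  have hRm : ∀ m, MeasurableSet (R m) := fun m =>
    measurableSet_similarity_image _ _ _ isOpen_interior.measurableSet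
  have hRint : ∀ m, t * (v / ((m + 2) * D)) ≤ ∫ Q in R m, (dist P' Q)⁻¹ := by
    intro m
    have hbd : ∀ x ∈ interior T,
        t⁻¹ * ((m + 2) * D)⁻¹ ≤ (dist P' (similarity (X m) (b j) t x))⁻¹ := by
      intro x hx
      rw [← mul_inv]
      have hne : P' ≠ similarity (X m) (b j) t x := fun h => by
        have h1 := hRi m _ (mem_image_of_mem _ hx)
        rw [← h, hP', coord_similarity, b.coord_apply_eq, hiP] at h1
        linarith
      refine inv_anti₀ (dist_pos.2 hne) ?_
      have h1 : P' - similarity (X m) (b j) t x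
          = t • ((b i - P) - (m : ℝ) • (b k - b j) - (x - b j)) := by
        simp only [hP', hX, similarity, smul_sub, mul_smul, smul_comm t (m : ℝ)]
        abel
      rw [dist_eq_norm, h1, norm_smul, Real.norm_of_nonneg ht0.le]
      refine mul_le_mul_of_nonneg_left ?_ ht0.le
      have h2 := norm_sub_le ((b i - P) - (m : ℝ) • (b k - b j)) (x - b j)
      have h3 := norm_sub_le (b i - P) ((m : ℝ) • (b k - b j))
      rw [norm_smul, Real.norm_natCast] at h3
      have h4 := hdist _ (hvert i) _ hPT
      have h5 := mul_le_mul_of_nonneg_left (hdist _ (hvert k) _ (hvert j))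
        (Nat.cast_nonneg (α := ℝ) m)
      have h6 := hdist _ (interior_subset hx) _ (hvert j)
      linarith
    have hRb : Bornology.IsBounded (R m) :=
      (hTc.image (continuous_similarity _ _ _)).isBounded.subset (image_mono interior_subset)
    calc _ = ∫ _ in R m, t⁻¹ * ((m + 2) * D)⁻¹ := by
          rw [hR, setIntegral_similarity_image _ _ ht0, setIntegral_const, ← hv, smul_eq_mul]
          field_simp
      _ ≤ ∫ Q in R m, (dist P' Q)⁻¹ :=
          setIntegral_mono_on (integrableOn_const hRb.measure_lt_top.ne)
            (integrableOn_inv_dist P' hRb (hRm m)) (hRm m) (forall_mem_image.2 hbd)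
  have hSm : MeasurableSet S := measurableSet_similarity_image _ _ _ hTm
  have hI : IntegrableOn (fun Q => (dist P' Q)⁻¹) T := integrableOn_inv_dist P' hTc.isBounded hTm
  have hRsub : ⋃ m ∈ Finset.range M, R m ⊆ T := iUnion₂_subset hRT
  have hle : (1 - t) * potential T P + ∑ m ∈ Finset.range M, t * (v / ((m + 2) * D))
      ≤ potential T P' := by
    calc _ ≤ (∫ Q in S, (dist P' Q)⁻¹) + ∑ m ∈ Finset.range M, ∫ Q in R m, (dist P' Q)⁻¹ :=
          add_le_add hSint.ge (Finset.sum_le_sum fun m _ => hRint m)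
      _ = ∫ Q in S ∪ ⋃ m ∈ Finset.range M, R m, (dist P' Q)⁻¹ := by
          rw [setIntegral_union _ (Finset.measurableSet_biUnion _ fun m _ => hRm m)
            (hI.mono_set hST) (hI.mono_set hRsub),
            integral_biUnion_finset _ (fun m _ => hRm m) _ fun m hm => hI.mono_set (hRT m hm)]
          · intro m _ n _ hmn
            rcases lt_or_gt_of_ne hmn with h | h
            · exact hRdisj m n h
            · exact (hRdisj n m h).symm
          · rw [Set.disjoint_left]
            intro x hx hx'
            obtain ⟨m, -, hm⟩ := mem_iUnion₂.1 hx'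
            exact (hSi x hx).not_gt (hRi m x hm)
      _ ≤ potential T P' :=
          setIntegral_mono_set hI (.of_forall fun Q => by positivity)
            (union_subset hST hRsub).eventuallyLE
  rw [← Finset.mul_sum] at hle
  have := hP P'
  nlinarith

end TrianglePotential

theorem potential_attains_max_interior
    (A B C : EuclideanSpace ℝ (Fin 2))
    (hABC : AffineIndependent ℝ ![A, B, C])
    (T : Set (EuclideanSpace ℝ (Fin 2)))
    (hT : T = convexHull ℝ {A, B, C})
    (V : EuclideanSpace ℝ (Fin 2) → ℝ)
    (hV : ∀ P, V P = ∫ Q in T, (dist P Q)⁻¹ ∂volume) :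
    ∃ P ∈ interior T, (∀ Q, V Q ≤ V P) ∧ gradient V P = 0 := by
  let b : AffineBasis (Fin 3) ℝ (EuclideanSpace ℝ (Fin 2)) :=
    ⟨![A, B, C], hABC, by
      rw [hABC.affineSpan_eq_top_iff_card_eq_finrank_add_one]
      simp⟩
  have hTb : T = convexHull ℝ (Set.range b) := by
    rw [hT]
    congr 1
    change _ = Set.range ![A, B, C]
    simp only [Matrix.range_cons, Matrix.range_empty, Set.union_empty, Set.singleton_union]
  have hVT : V = TrianglePotential.potential T := funext hV
  subst hVT hTb
  obtain ⟨P, hPT, hmax⟩ := TrianglePotential.exists_forall_potential_le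
    (convex_convexHull ℝ (Set.range b)) ((Set.finite_range b).isCompact_convexHull (𝕜 := ℝ))
    (Set.range_nonempty b).convexHull
  refine ⟨P, ?_, hmax, ?_⟩
  · rw [AffineBasis.convexHull_eq_nonneg_coord] at hPT
    rw [b.interior_convexHull]
    intro i
    refine lt_of_le_of_ne (hPT i) fun h0 => ?_
    obtain ⟨j, k, hij, hik, hjk, hj⟩ : ∃ j k : Fin 3, i ≠ j ∧ i ≠ k ∧ j ≠ k ∧
        1 / 2 ≤ b.coord j P := by
      have hsum := b.sum_coord_apply_eq_one P
      rw [Fin.sum_univ_three] at hsum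
      by_contra! hcon
      fin_cases i
      · have h1 := hcon 1 2 (by decide) (by decide) (by decide)
        have h2 := hcon 2 1 (by decide) (by decide) (by decide)
        simp at h0
        linarith
      · have h1 := hcon 0 2 (by decide) (by decide) (by decide)
        have h2 := hcon 2 0 (by decide) (by decide) (by decide)
        simp at h0
        linarith
      · have h1 := hcon 0 1 (by decide) (by decide) (by decide)
        have h2 := hcon 1 0 (by decide) (by decide) (by decide)
        simp at h0
        linarith
    exact TrianglePotential.coord_ne_zero_of_forall_potential_le b hij hik hjk hj (hPT k) hmax
      h0.symm
  · have hloc : IsLocalMax (TrianglePotential.potential (convexHull ℝ (Set.range b))) P :=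
      Filter.Eventually.of_forall hmax
    rw [gradient, hloc.fderiv_eq_zero, map_zero]
end

section
/- Polar representation of the field: for every point P in the interior of T, gradient V P = ∫ φ in (0)..(2π), (Real.log (R φ)) • (u φ) dφ, where u φ ∈ E is the unit vector with coordinates (cos φ, sin φ) and R φ = sSup {r : ℝ | 0 ≤ r ∧ P + r • u φ ∈ T} is the length of the polar ray from P to the boundary of T in direction φ. -/
open MeasureTheory Real

open Set Metric Filter Topology

local notation "ℝ²" => EuclideanSpace ℝ (Fin 2)

/-- The vector field `x / ‖x‖ ^ 3`, cut off inside the closed ball of radius `ε`. -/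
noncomputable def cutoffField (ε : ℝ) (x : ℝ²) : ℝ² :=
  if ε < ‖x‖ then (‖x‖ ^ 3)⁻¹ • x else 0

theorem measurable_cutoffField (ε : ℝ) : Measurable (cutoffField ε) := by
  refine Measurable.ite (measurableSet_lt measurable_const measurable_norm) ?_ measurable_const
  fun_prop

theorem norm_cutoffField_le {ε : ℝ} (hε : 0 < ε) (x : ℝ²) :
    ‖cutoffField ε x‖ ≤ (ε ^ 2)⁻¹ := by
  unfold cutoffField
  split_ifs with h
  · have hx : 0 < ‖x‖ := hε.trans h
    rw [norm_smul, norm_inv, norm_pow, norm_norm]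
    have : (‖x‖ ^ 3)⁻¹ * ‖x‖ = (‖x‖ ^ 2)⁻¹ := by field_simp
    rw [this]
    gcongr
  · simp only [norm_zero]; positivity

theorem abs_inv_max_sub_inv_max_le {ε : ℝ} (hε : 0 < ε) (a b : ℝ) :
    |(max a ε)⁻¹ - (max b ε)⁻¹| ≤ (ε ^ 2)⁻¹ * |a - b| := by
  have ha : ε ≤ max a ε := le_max_right _ _
  have hb : ε ≤ max b ε := le_max_right _ _
  rw [inv_sub_inv (hε.trans_le ha).ne' (hε.trans_le hb).ne', abs_div, abs_mul,
    abs_of_pos (hε.trans_le ha), abs_of_pos (hε.trans_le hb), abs_sub_comm,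
    ← div_eq_inv_mul]
  refine div_le_div₀ (abs_nonneg _) (abs_max_sub_max_le_abs a b ε) (by positivity) ?_
  nlinarith

/-- The difference between the Newtonian kernel and its truncation at radius `ε` is integrable. -/
theorem integrable_inv_norm_sub_inv_max (ε : ℝ) (hε : 0 < ε) :
    Integrable (fun x : ℝ² => ‖x‖⁻¹ - (max ‖x‖ ε)⁻¹) := by
  rw [integrable_fun_norm_addHaar (volume : Measure ℝ²) (f := fun y => y⁻¹ - (max y ε)⁻¹)]
  simp only [finrank_euclideanSpace, Fintype.card_fin, Nat.add_one_sub_one, pow_one, smul_eq_mul]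
  have hint : IntegrableOn (fun y : ℝ => 1 - y * ε⁻¹) (Ioc 0 ε) :=
    (Continuous.integrableOn_Icc (by fun_prop)).mono_set Ioc_subset_Icc_self
  refine IntegrableOn.of_forall_sdiff_eq_zero (s := Ioc 0 ε) ?_ measurableSet_Ioi ?_
  · refine hint.congr_fun (fun y hy => ?_) measurableSet_Ioc
    have := hy.1.ne'
    simp only [max_eq_right hy.2]
    field_simp
  · rintro y ⟨hy, hy'⟩
    have : ε ≤ y := by
      by_contra! h
      exact hy' ⟨hy, h.le⟩
    simp [max_eq_left this]

theorem hasFDerivAt_inv_max_norm_sub {ε : ℝ} (hε : 0 < ε) {P Q : ℝ²} (h : ‖Q - P‖ ≠ ε) :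
    HasFDerivAt (fun x => (max ‖Q - x‖ ε)⁻¹) (innerSL ℝ (cutoffField ε (Q - P))) P := by
  have hc : ContinuousAt (fun x => ‖Q - x‖) P := by fun_prop
  rcases lt_or_gt_of_ne h with h | h
  · have h0 : cutoffField ε (Q - P) = 0 := if_neg h.le.not_gt
    rw [h0, map_zero]
    refine (hasFDerivAt_const ε⁻¹ P).congr_of_eventuallyEq ?_
    filter_upwards [hc.eventually_lt continuousAt_const h] with x hx
    simp [max_eq_right hx.le]
  · have hpos : 0 < ‖Q - P‖ := hε.trans h
    have h1 : HasFDerivAt (fun x => ‖Q - x‖ ^ 2) (2 • innerSL ℝ (Q - P) ∘L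
        (-ContinuousLinearMap.id ℝ ℝ²)) P :=
      ((hasFDerivAt_id P).const_sub Q).norm_sq
    have h2 := h1.sqrt (by positivity)
    simp only [sqrt_sq (norm_nonneg _)] at h2
    replace h2 := (hasDerivAt_inv hpos.ne').comp_hasFDerivAt P h2
    have h3 : HasFDerivAt (fun x => (max ‖Q - x‖ ε)⁻¹) _ P := h2.congr_of_eventuallyEq ?_
    · refine h3.congr_fderiv (ContinuousLinearMap.ext fun v => ?_)
      simp [cutoffField, h]
      field_simp
      ring
    · filter_upwards [continuousAt_const.eventually_lt hc h] with x hx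
      simp [max_eq_left hx.le]

/-- Differentiation of the potential of the truncated kernel under the integral sign. -/
theorem hasGradientAt_truncated_potential {T : Set ℝ²} (hT : volume T ≠ ⊤) {ε : ℝ} (hε : 0 < ε)
    (P : ℝ²) :
    HasGradientAt (fun x => ∫ Q in T, (max ‖Q - x‖ ε)⁻¹) (∫ Q in T, cutoffField ε (Q - P)) P := by
  have : IsFiniteMeasure (volume.restrict T) := ⟨by simpa using hT.lt_top⟩
  have hm : Measurable fun Q => cutoffField ε (Q - P) :=
    (measurable_cutoffField ε).comp (measurable_id.sub_const P)
  have hG : Integrable (fun Q => cutoffField ε (Q - P)) (volume.restrict T) :=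
    Integrable.of_bound hm.aestronglyMeasurable _ (ae_of_all _ fun Q => norm_cutoffField_le hε _)
  have hF := hasFDerivAt_integral_of_dominated_loc_of_lip (μ := volume.restrict T) (𝕜 := ℝ)
    (F := fun x Q => (max ‖Q - x‖ ε)⁻¹) (x₀ := P) (s := univ) (bound := fun _ => (ε ^ 2)⁻¹)
    (F' := fun Q => innerSL ℝ (cutoffField ε (Q - P))) univ_mem
    (Eventually.of_forall fun x => by
      have : Measurable fun Q : ℝ² => (max ‖Q - x‖ ε)⁻¹ := by fun_prop
      exact this.aestronglyMeasurable)
    (by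
      have : Measurable fun Q : ℝ² => (max ‖Q - P‖ ε)⁻¹ := by fun_prop
      refine Integrable.of_bound this.aestronglyMeasurable ε⁻¹ (ae_of_all _ fun Q => ?_)
      have : ε ≤ max ‖Q - P‖ ε := le_max_right _ _
      rw [norm_inv, norm_of_nonneg (hε.le.trans this)]
      gcongr)
    ((innerSL ℝ).continuous.comp_aestronglyMeasurable hm.aestronglyMeasurable)
    (ae_of_all _ fun Q => by
      refine LipschitzOnWith.of_dist_le_mul fun x _ y _ => ?_
      rw [Real.dist_eq, Real.coe_nnabs, abs_of_pos (a := (ε ^ 2)⁻¹) (by positivity)]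
      refine (abs_inv_max_sub_inv_max_le hε _ _).trans ?_
      gcongr
      refine (abs_norm_sub_norm_le _ _).trans_eq ?_
      rw [sub_sub_sub_cancel_left, dist_eq_norm, norm_sub_rev])
    (integrable_const _)
    (by
      have hs : ∀ᵐ Q ∂(volume : Measure ℝ²), Q ∉ sphere P ε :=
        measure_eq_zero_iff_ae_notMem.1 (Measure.addHaar_sphere volume P ε)
      filter_upwards [ae_restrict_of_ae hs] with Q hQ
      exact hasFDerivAt_inv_max_norm_sub hε fun h => hQ (by simpa [dist_eq_norm] using h))
  rw [hasGradientAt_iff_hasFDerivAt]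
  refine hF.2.congr_fderiv (ContinuousLinearMap.ext fun v => ?_)
  rw [ContinuousLinearMap.integral_apply hF.1]
  simp only [innerSL_apply_apply, InnerProductSpace.toDual_apply_apply]
  rw [real_inner_comm, ← integral_inner hG]
  simp only [real_inner_comm]

/-- Near an interior point the Newtonian potential differs from the truncated one by a constant. -/
theorem hasGradientAt_potential_s8 {T : Set ℝ²} (hT : volume T ≠ ⊤) {ε : ℝ} (hε : 0 < ε)
    {P : ℝ²} (hP : closedBall P (2 * ε) ⊆ T) :
    HasGradientAt (fun x => ∫ Q in T, (dist x Q)⁻¹) (∫ Q in T, cutoffField ε (Q - P)) P := by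
  have : IsFiniteMeasure (volume.restrict T) := ⟨by simpa using hT.lt_top⟩
  have h := (hasGradientAt_truncated_potential hT hε P).hasFDerivAt.add_const
    (∫ x : ℝ², (‖x‖⁻¹ - (max ‖x‖ ε)⁻¹))
  rw [hasGradientAt_iff_hasFDerivAt]
  refine h.congr_of_eventuallyEq ?_
  filter_upwards [ball_mem_nhds P hε] with x hx
  have hk : Integrable (fun Q : ℝ² => ‖Q - x‖⁻¹ - (max ‖Q - x‖ ε)⁻¹) :=
    (integrable_inv_norm_sub_inv_max ε hε).comp_sub_right x
  have hm : Measurable fun Q : ℝ² => (max ‖Q - x‖ ε)⁻¹ := by fun_prop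
  have hb : Integrable (fun Q : ℝ² => (max ‖Q - x‖ ε)⁻¹) (volume.restrict T) := by
    refine Integrable.of_bound hm.aestronglyMeasurable ε⁻¹ (ae_of_all _ fun Q => ?_)
    have : ε ≤ max ‖Q - x‖ ε := le_max_right _ _
    rw [norm_inv, norm_of_nonneg (hε.le.trans this)]
    gcongr
  have hout : ∀ Q, Q ∉ T → ‖Q - x‖⁻¹ - (max ‖Q - x‖ ε)⁻¹ = 0 := by
    intro Q hQ
    have : ε ≤ ‖Q - x‖ := by
      by_contra! hlt
      refine hQ (hP ?_)
      have := dist_triangle Q x P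
      rw [mem_ball] at hx
      rw [mem_closedBall]
      rw [← dist_eq_norm] at hlt
      linarith
    simp [max_eq_left this]
  have e1 := integral_add hb hk.integrableOn
  rw [setIntegral_eq_integral_of_forall_compl_eq_zero hout,
    integral_sub_right_eq_self (fun Q : ℝ² => ‖Q‖⁻¹ - (max ‖Q‖ ε)⁻¹) x] at e1
  rw [← e1]
  simp [dist_eq_norm, norm_sub_rev]

/-- The unit vector with polar angle `φ`. -/
noncomputable def polarUnit (φ : ℝ) : ℝ² := !₂[cos φ, sin φ]

theorem continuous_polarUnit : Continuous polarUnit := by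
  unfold polarUnit
  refine (PiLp.continuous_toLp 2 _).comp (continuous_pi fun i => ?_)
  fin_cases i <;> simp <;> fun_prop

theorem norm_polarUnit (φ : ℝ) : ‖polarUnit φ‖ = 1 := by
  simp [polarUnit, EuclideanSpace.norm_eq]

theorem polarUnit_add_two_pi (φ : ℝ) : polarUnit (φ + 2 * π) = polarUnit φ := by
  simp [polarUnit]

theorem norm_smul_polarUnit {r : ℝ} (hr : 0 ≤ r) (φ : ℝ) : ‖r • polarUnit φ‖ = r := by
  rw [norm_smul, norm_polarUnit, mul_one, norm_of_nonneg hr]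

theorem integral_polarUnit : ∫ φ in Ioo (-π) π, polarUnit φ = 0 := by
  have hi : IntegrableOn polarUnit (Ioo (-π) π) :=
    continuous_polarUnit.integrableOn_Icc.mono_set Ioo_subset_Icc_self
  have key : ∀ i : Fin 2, (∫ φ in Ioo (-π) π, polarUnit φ) i = ∫ φ in Ioo (-π) π, polarUnit φ i :=
    fun i => ((EuclideanSpace.proj (𝕜 := ℝ) i).integral_comp_comm hi).symm
  ext i
  rw [key, ← integral_Ioc_eq_integral_Ioo, ← intervalIntegral.integral_of_le (by linarith [pi_pos])]
  fin_cases i <;> simp [polarUnit]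

theorem integral_eq_polar {F : Type*} [NormedAddCommGroup F] [NormedSpace ℝ F] (f : ℝ² → F) :
    ∫ x, f x = ∫ p in Ioi (0 : ℝ) ×ˢ Ioo (-π) π, p.1 • f (p.1 • polarUnit p.2) := by
  rw [← Complex.orthonormalBasisOneI.measurePreserving_repr.integral_comp
    Complex.orthonormalBasisOneI.repr.toHomeomorph.measurableEmbedding,
    ← Complex.integral_comp_polarCoord_symm, polarCoord_target]
  refine integral_congr_ae (ae_of_all _ fun p => ?_)
  simp only
  congr 2
  ext i
  rw [Complex.orthonormalBasisOneI_repr_apply]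
  fin_cases i <;> simp [polarUnit, -Complex.ofReal_cos, -Complex.ofReal_sin]

/-- A ray from `P` meets a compact convex set in a segment, whose length is the given supremum. -/
theorem Convex.setOf_ray_eq_Icc {T : Set ℝ²} (hc : Convex ℝ T) (hk : IsCompact T) {P : ℝ²}
    (hP : P ∈ T) {v : ℝ²} (hv : v ≠ 0) :
    {r : ℝ | 0 ≤ r ∧ P + r • v ∈ T} = Icc 0 (sSup {r : ℝ | 0 ≤ r ∧ P + r • v ∈ T}) := by
  set S := {r : ℝ | 0 ≤ r ∧ P + r • v ∈ T}
  have hcont : Continuous fun r : ℝ => P + r • v := by fun_prop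
  have hcl : IsClosed S := isClosed_Ici.inter (hk.isClosed.preimage hcont)
  have hbdd : BddAbove S := by
    obtain ⟨M, hM⟩ := hk.isBounded.subset_closedBall P
    refine ⟨M / ‖v‖, fun r hr => ?_⟩
    have := hM hr.2
    rw [mem_closedBall, dist_eq_norm, add_sub_cancel_left, norm_smul, norm_of_nonneg hr.1] at this
    rwa [le_div_iff₀ (norm_pos_iff.2 hv)]
  have hne : S.Nonempty := ⟨0, le_rfl, by simpa using hP⟩
  refine Subset.antisymm (fun r hr => ⟨hr.1, le_csSup hbdd hr⟩) fun r hr => ⟨hr.1, ?_⟩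
  have hS := (hcl.csSup_mem hne hbdd).2
  have hconv : Convex ℝ ((fun r : ℝ => P + r • v) ⁻¹' T) := by
    intro a ha b hb s t hs ht hst
    have := hc ha hb hs ht hst
    simp only [mem_preimage]
    convert this using 1
    rw [show t = 1 - s by linarith]
    module
  exact hconv.ordConnected.out (by simpa using hP) hS hr

theorem integral_cutoffField_eq {T : Set ℝ²} (hc : Convex ℝ T) (hk : IsCompact T) {ε : ℝ}
    (hε : 0 < ε) {P : ℝ²} (hP : closedBall P ε ⊆ T) {R : ℝ → ℝ}
    (hR : ∀ φ, R φ = sSup {r : ℝ | 0 ≤ r ∧ P + r • polarUnit φ ∈ T}) :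
    ∫ Q in T, cutoffField ε (Q - P) = ∫ φ in Ioo (-π) π, log (R φ) • polarUnit φ := by
  have hmem : ∀ φ r, (0 ≤ r ∧ P + r • polarUnit φ ∈ T) ↔ 0 ≤ r ∧ r ≤ R φ := fun φ r => by
    have := hc.setOf_ray_eq_Icc hk (hP (mem_closedBall_self hε.le)) (v := polarUnit φ)
      (norm_ne_zero_iff.1 (by simp [norm_polarUnit]))
    rw [← hR] at this
    exact Set.ext_iff.1 this r
  have hεR : ∀ φ, ε ≤ R φ := fun φ => ((hmem φ ε).1 ⟨hε.le, hP (by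
    simp [norm_smul_polarUnit hε.le])⟩).2
  obtain ⟨M, hM⟩ := hk.isBounded.subset_closedBall P
  set f : ℝ × ℝ → ℝ² := fun p =>
    p.1 • T.indicator (fun Q => cutoffField ε (Q - P)) (p.1 • polarUnit p.2 + P) with hf
  have hfeq : ∀ φ r, 0 < r → f (r, φ) = (Ioc ε (R φ)).indicator (fun r => r⁻¹ • polarUnit φ) r := by
    intro φ r hr
    have hT : r • polarUnit φ + P ∈ T ↔ r ≤ R φ := by
      have := hmem φ r
      rw [add_comm]
      simpa [hr.le] using this
    simp only [hf, indicator, hT, mem_Ioc, add_sub_cancel_right, cutoffField,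
      norm_smul_polarUnit hr.le]
    by_cases h1 : ε < r <;> by_cases h2 : r ≤ R φ <;> simp [h1, h2, smul_smul]
    field_simp
  have hfm : Measurable f := by
    refine measurable_fst.smul (Measurable.comp (Measurable.indicator ?_ hk.measurableSet) ?_)
    · exact (measurable_cutoffField ε).comp (measurable_id.sub_const P)
    · have := continuous_polarUnit
      exact Continuous.measurable (by fun_prop)
  have hRM : ∀ φ, R φ ≤ M := fun φ => by
    have h0 := hε.le.trans (hεR φ)
    have := hM ((hmem φ (R φ)).2 ⟨h0, le_rfl⟩).2
    simpa [norm_smul_polarUnit h0] using this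
  have hfi : IntegrableOn f (Ioi 0 ×ˢ Ioo (-π) π) := by
    have hs : MeasurableSet (Ioc 0 M ×ˢ Ioo (-π) π) := measurableSet_Ioc.prod measurableSet_Ioo
    refine IntegrableOn.of_forall_sdiff_eq_zero (s := Ioc 0 M ×ˢ Ioo (-π) π) ?_
      (measurableSet_Ioi.prod measurableSet_Ioo) ?_
    · refine Measure.integrableOn_of_bounded (M := ε⁻¹) ?_ hfm.aestronglyMeasurable ?_
      · rw [Measure.volume_eq_prod, Measure.prod_prod]
        simp [ENNReal.mul_eq_top]
      · filter_upwards [ae_restrict_mem hs] with p hp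
        rw [hfeq p.2 p.1 hp.1.1]
        by_cases h : p.1 ∈ Ioc ε (R p.2)
        · rw [indicator_of_mem h, norm_smul, norm_polarUnit, mul_one, norm_inv,
            norm_of_nonneg hp.1.1.le]
          gcongr
          exact h.1.le
        · rw [indicator_of_notMem h, norm_zero]
          positivity
    · rintro p ⟨hp, hp'⟩
      rw [hfeq p.2 p.1 hp.1]
      refine indicator_of_notMem (fun h => hp' ⟨⟨hp.1, h.2.trans (hRM _)⟩, hp.2⟩) _
  have hinner : ∀ φ, ∫ r in Ioi 0, f (r, φ) = log (R φ) • polarUnit φ - log ε • polarUnit φ := by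
    intro φ
    rw [setIntegral_congr_fun measurableSet_Ioi (fun r hr => hfeq φ r hr),
      setIntegral_indicator measurableSet_Ioc,
      inter_eq_self_of_subset_right (Ioc_subset_Ioi_self.trans (Ioi_subset_Ioi hε.le)), integral_smul_const,
      ← intervalIntegral.integral_of_le (hεR φ),
      integral_inv_of_pos hε (hε.trans_le (hεR φ)), log_div (hε.trans_le (hεR φ)).ne' hε.ne',
      sub_smul]
  have hconst : IntegrableOn (fun φ => log ε • polarUnit φ) (Ioo (-π) π) :=
    (continuous_polarUnit.const_smul (log ε)).integrableOn_Icc.mono_set Ioo_subset_Icc_self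
  rw [IntegrableOn, Measure.volume_eq_prod, ← Measure.prod_restrict] at hfi
  have hlog : IntegrableOn (fun φ => log (R φ) • polarUnit φ) (Ioo (-π) π) := by
    have := hfi.integral_prod_right
    simp only [hinner] at this
    exact (this.add hconst).congr (ae_of_all _ fun φ => by simp)
  rw [← integral_indicator hk.measurableSet, ← integral_add_right_eq_self _ P, integral_eq_polar,
    Measure.volume_eq_prod, ← Measure.prod_restrict, integral_prod_symm _ hfi]
  refine (integral_congr_ae (ae_of_all _ hinner)).trans ?_
  rw [integral_sub hlog hconst, integral_smul, integral_polarUnit, smul_zero, sub_zero]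

theorem gradient_polar_representation
    (A B C : EuclideanSpace ℝ (Fin 2))
    (hABC : AffineIndependent ℝ ![A, B, C])
    (T : Set (EuclideanSpace ℝ (Fin 2)))
    (hT : T = convexHull ℝ {A, B, C})
    (V : EuclideanSpace ℝ (Fin 2) → ℝ)
    (hV : ∀ P, V P = ∫ Q in T, (dist P Q)⁻¹ ∂volume)
    (P : EuclideanSpace ℝ (Fin 2)) (hP : P ∈ interior T)
    (u : ℝ → EuclideanSpace ℝ (Fin 2))
    (hu : ∀ φ, u φ = (WithLp.equiv 2 (Fin 2 → ℝ)).symm ![Real.cos φ, Real.sin φ])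
    (R : ℝ → ℝ)
    (hR : ∀ φ, R φ = sSup {r : ℝ | 0 ≤ r ∧ P + r • u φ ∈ T}) :
    gradient V P = ∫ φ in (0)..(2 * π), (Real.log (R φ)) • (u φ) := by
  obtain rfl : u = polarUnit := funext hu
  obtain rfl : V = fun P => ∫ Q in T, (dist P Q)⁻¹ := funext hV
  have hc : Convex ℝ T := hT ▸ convex_convexHull ℝ _
  have hk : IsCompact T := hT ▸ (toFinite {A, B, C}).isCompact_convexHull ℝ
  obtain ⟨δ, hδ, hball⟩ := nhds_basis_closedBall.mem_iff.1 (mem_interior_iff_mem_nhds.1 hP)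
  have hball' : closedBall P (δ / 2) ⊆ T := (closedBall_subset_closedBall (by linarith)).trans hball
  rw [(hasGradientAt_potential_s8 hk.measure_lt_top.ne (half_pos hδ)
    (by rwa [show 2 * (δ / 2) = δ by ring])).gradient,
    integral_cutoffField_eq hc hk (half_pos hδ) hball' hR, ← integral_Ioc_eq_integral_Ioo,
    ← intervalIntegral.integral_of_le (by linarith [pi_pos])]
  have hper : Function.Periodic (fun φ => log (R φ) • polarUnit φ) (2 * π) := fun φ => by
    simp only [hR, polarUnit_add_two_pi]
  have := hper.intervalIntegral_add_eq (-π) 0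
  rwa [zero_add, show -π + 2 * π = π by ring] at this
end

section
/- Theorem 1, second relation: if P is a point in the interior of the triangle T with gradient V P = 0, then, writing α = ∠ B A C, β = ∠ C B A, γ = ∠ A C B for the angles of the triangle and α₁ = ∠ B A P, α₂ = ∠ P A C, β₁ = ∠ C B P, β₂ = ∠ P B A, γ₁ = ∠ A C P, γ₂ = ∠ P C B for the angles that P subtends at the vertices, one has (tan(β₁/2) · tan(γ₂/2)) ^ (1/sin α) = (tan(γ₁/2) · tan(α₂/2)) ^ (1/sin β) = (tan(α₁/2) · tan(β₂/2)) ^ (1/sin γ), where x ^ y denotes Real.rpow. -/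
open MeasureTheory EuclideanGeometry Real

theorem hasFDerivAt_setIntegral_sub_of_contDiff {E : Type*} [NormedAddCommGroup E]
    [NormedSpace ℝ E] [FiniteDimensional ℝ E] [MeasurableSpace E] [BorelSpace E] {μ : Measure E}
    [IsFiniteMeasureOnCompacts μ] {T : Set E} (hT : IsCompact T) {g : E → ℝ}
    (hg : ContDiff ℝ 1 g) (P : E) :
    HasFDerivAt (fun P' => ∫ Q in T, g (P' - Q) ∂μ) (∫ Q in T, fderiv ℝ g (P - Q) ∂μ) P := by
  have hc : Continuous (fderiv ℝ g) := hg.continuous_fderiv one_ne_zero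
  have hK : IsCompact ((fun p : E × E => p.1 - p.2) '' (Metric.closedBall P 1 ×ˢ T)) :=
    ((isCompact_closedBall P 1).prod hT).image (by fun_prop)
  obtain ⟨M, hM⟩ := hK.exists_bound_of_continuousOn hc.continuousOn
  have : IsFiniteMeasure (μ.restrict T) := ⟨by simpa using hT.measure_lt_top⟩
  refine hasFDerivAt_integral_of_dominated_of_fderiv_le (bound := fun _ => M)
    (F := fun P' Q => g (P' - Q)) (F' := fun P' Q => fderiv ℝ g (P' - Q))
    (Metric.closedBall_mem_nhds P one_pos) ?_ ?_ ?_ ?_ (integrable_const M) ?_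
  · exact .of_forall fun x => (hg.continuous.comp (by fun_prop)).aestronglyMeasurable
  · exact (hg.continuous.comp (by fun_prop)).continuousOn.integrableOn_compact hT
  · exact (hc.comp (by fun_prop)).aestronglyMeasurable
  · filter_upwards [ae_restrict_mem hT.measurableSet] with Q hQ x hx
    exact hM _ ⟨(x, Q), ⟨hx, hQ⟩, rfl⟩
  · refine .of_forall fun Q x _ => ?_
    have := (hg.differentiable one_ne_zero (x - Q)).hasFDerivAt.comp x
      ((hasFDerivAt_id x).sub_const Q)
    simpa [Function.comp_def] using this

/-- Near an interior point of `T`, a potential `∫ Q in T, ‖P' - Q‖⁻¹` differs by a constant from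
one with a smooth kernel. -/
theorem exists_contDiff_kernel {E : Type*} [NormedAddCommGroup E]
    [InnerProductSpace ℝ E] [FiniteDimensional ℝ E] [MeasurableSpace E] [BorelSpace E]
    (hE : 2 ≤ Module.finrank ℝ E) {μ : Measure E}
    [μ.IsAddHaarMeasure] {T : Set E} (hT : IsCompact T) {P : E} {r : ℝ} (hr : 0 < r)
    (hP : Metric.ball P r ⊆ T) :
    ∃ g : E → ℝ, ContDiff ℝ 1 g ∧ (∀ x, r ≤ ‖x‖ → g x = ‖x‖⁻¹) ∧
      ∃ c : ℝ, ∀ᶠ P' in nhds P,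
        ∫ Q in T, ‖P' - Q‖⁻¹ ∂μ = c + ∫ Q in T, g (P' - Q) ∂μ := by
  let f : ContDiffBump (0 : E) := ⟨r / 4, r / 2, by positivity, by linarith⟩
  have : Nontrivial E := Module.nontrivial_of_finrank_pos (R := ℝ) (by omega)
  have hgc : ContDiff ℝ 1 fun x : E => (1 - f x) * ‖x‖⁻¹ := by
    rw [contDiff_iff_contDiffAt]
    intro x
    by_cases hx : x = 0
    · subst hx
      refine (contDiffAt_const (c := (0 : ℝ))).congr_of_eventuallyEq ?_
      filter_upwards [f.eventuallyEq_one] with y hy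
      simp [hy]
    · exact (contDiffAt_const.sub f.contDiffAt).mul ((contDiffAt_norm ℝ hx).inv (by simpa using hx))
  have hint : Integrable (fun x : E => f x * ‖x‖⁻¹) μ := by
    have h1 : Integrable (fun x : E => (Set.Iio r).indicator (fun y : ℝ => y⁻¹) ‖x‖) μ := by
      rw [integrable_fun_norm_addHaar μ (f := (Set.Iio r).indicator (fun y : ℝ => y⁻¹))]
      have h2 : IntegrableOn ((Set.Iio r).indicator fun y : ℝ => y ^ (Module.finrank ℝ E - 2))
          (Set.Ioi 0) := by
        rw [← integrable_indicator_iff measurableSet_Ioi, Set.indicator_indicator,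
          integrable_indicator_iff (measurableSet_Ioi.inter measurableSet_Iio)]
        exact ((continuous_pow _).continuousOn.integrableOn_Icc (a := 0) (b := r)).mono_set
          fun x hx => ⟨hx.1.le, hx.2.le⟩
      refine h2.congr_fun (fun y hy => ?_) measurableSet_Ioi
      have hy0 : y ≠ 0 := ne_of_gt hy
      by_cases hyr : y < r
      · simp only [Set.indicator_of_mem (show y ∈ Set.Iio r from hyr), smul_eq_mul]
        obtain ⟨k, hk⟩ := Nat.exists_eq_add_of_le' hE
        rw [hk, show k + 2 - 1 = k + 1 by omega, show k + 2 - 2 = k by omega]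
        field_simp
        ring
      · simp [hyr]
    refine h1.mono' ((f.continuous.measurable.mul
      measurable_norm.inv).aestronglyMeasurable) (.of_forall fun x => ?_)
    by_cases hx : ‖x‖ < r
    · rw [Set.indicator_of_mem (by exact hx), norm_mul, norm_inv, norm_norm,
        Real.norm_of_nonneg f.nonneg]
      exact mul_le_of_le_one_left (by positivity) f.le_one
    · rw [f.zero_of_le_dist (by simp [f]; linarith)]
      simp [hx]
  refine ⟨_, hgc, fun x hx => ?_, ∫ x, f x * ‖x‖⁻¹ ∂μ, ?_⟩
  · rw [f.zero_of_le_dist (by simp [f]; linarith)]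
    simp
  · filter_upwards [Metric.ball_mem_nhds P (half_pos hr)] with P' hP'
    have h1 : ∫ Q in T, f (P' - Q) * ‖P' - Q‖⁻¹ ∂μ = ∫ x, f x * ‖x‖⁻¹ ∂μ := by
      rw [← integral_sub_left_eq_self _ μ P']
      refine setIntegral_eq_integral_of_forall_compl_eq_zero fun Q hQ => ?_
      rw [f.zero_of_le_dist, zero_mul]
      by_contra! h
      refine hQ (hP ?_)
      simp only [f, dist_zero_right, Metric.mem_ball] at h hP' ⊢
      have := dist_triangle Q P' P
      rw [dist_comm Q P', dist_eq_norm P' Q] at this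
      linarith
    rw [← h1, ← integral_add]
    · congr with Q
      ring
    · exact (hint.comp_sub_left P').integrableOn
    · exact (hgc.continuous.comp (by fun_prop)).continuousOn.integrableOn_compact hT

theorem convexHull_triple_eq {E : Type*} [AddCommGroup E] [Module ℝ E] (A B C : E) :
    convexHull ℝ {B, A, C} = {Q | ∃ x y : ℝ, 0 ≤ x ∧ 0 ≤ y ∧ x + y ≤ 1 ∧
      Q = B + (x • (A - B) + y • (C - B))} := by
  ext Q
  simp only [convexHull_insert (Set.insert_nonempty _ _), convexHull_pair,
    Set.mem_ofPred_eq, mem_convexJoin, Set.mem_singleton_iff, exists_eq_left]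
  constructor
  · rintro ⟨R, ⟨a, b, ha, hb, hab, rfl⟩, c, d, hc, hd, hcd, rfl⟩
    refine ⟨d * a, d * b, by positivity, by positivity, ?_, ?_⟩
    · rw [← mul_add, hab]; linarith
    · obtain rfl : b = 1 - a := by linarith
      obtain rfl : c = 1 - d := by linarith
      module
  · rintro ⟨x, y, hx, hy, hxy, rfl⟩
    rcases eq_or_ne (x + y) 0 with h | h
    · obtain rfl : x = 0 := by linarith
      obtain rfl : y = 0 := by linarith
      exact ⟨A, left_mem_segment _ _ _, by simpa using left_mem_segment _ _ _⟩
    · refine ⟨(x / (x + y)) • A + (y / (x + y)) • C,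
        ⟨_, _, by positivity, by positivity, by field_simp, rfl⟩,
        1 - (x + y), x + y, by linarith, by positivity, by ring, ?_⟩
      simp only [smul_add, smul_smul, mul_div_cancel₀ _ h]
      module

theorem integral_deriv_simplex {H H' : ℝ → ℝ → ℝ}
    (hc : Continuous fun p : ℝ × ℝ => H' p.1 p.2)
    (hd : ∀ x y, HasDerivAt (H x) (H' x y) y) :
    ∫ p in {p : ℝ × ℝ | 0 ≤ p.1 ∧ 0 ≤ p.2 ∧ p.1 + p.2 ≤ 1}, H' p.1 p.2
      = ∫ x in (0 : ℝ)..1, (H x (1 - x) - H x 0) := by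
  set S := {p : ℝ × ℝ | 0 ≤ p.1 ∧ 0 ≤ p.2 ∧ p.1 + p.2 ≤ 1}
  have hS : IsClosed S := by
    refine (isClosed_le continuous_const continuous_fst).inter
      ((isClosed_le continuous_const continuous_snd).inter
      (isClosed_le (continuous_fst.add continuous_snd) continuous_const))
  have hSc : IsCompact S := by
    refine (isCompact_Icc (a := ((0 : ℝ), (0 : ℝ))) (b := (1, 1))).of_isClosed_subset hS ?_
    rintro ⟨x, y⟩ ⟨h1, h2, h3⟩
    simp only at h1 h2 h3
    exact ⟨⟨h1, h2⟩, ⟨by simp; linarith, by simp; linarith⟩⟩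
  have hint : Integrable (S.indicator fun p : ℝ × ℝ => H' p.1 p.2) (volume.prod volume) :=
    (hc.continuousOn.integrableOn_compact hSc).integrable_indicator hS.measurableSet
  rw [← integral_indicator hS.measurableSet, Measure.volume_eq_prod, integral_prod _ hint,
    intervalIntegral.integral_of_le zero_le_one, ← integral_Icc_eq_integral_Ioc,
    ← integral_indicator measurableSet_Icc]
  congr with x
  by_cases hx : x ∈ Set.Icc (0 : ℝ) 1
  · rw [Set.indicator_of_mem hx, ← intervalIntegral.integral_eq_sub_of_hasDerivAt
      (fun y _ => hd x y) ((hc.comp (Continuous.prodMk_right x)).intervalIntegrable _ _),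
      intervalIntegral.integral_of_le (by linarith [hx.2]), ← integral_Icc_eq_integral_Ioc,
      ← integral_indicator measurableSet_Icc]
    congr with y
    have : (x, y) ∈ S ↔ y ∈ Set.Icc 0 (1 - x) :=
      ⟨fun h => ⟨h.2.1, by linarith [h.2.2]⟩, fun h => ⟨hx.1, h.1, by simp; linarith [h.2]⟩⟩
    by_cases hy : y ∈ Set.Icc 0 (1 - x) <;> simp only [Set.indicator, this, hy, if_true, if_false]
  · rw [Set.indicator_of_notMem hx]
    have : ∀ y, (x, y) ∉ S := fun y h => hx ⟨h.1, by
      have h1 := h.2.1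
      have h2 := h.2.2
      simp only at h1 h2
      linarith⟩
    simp [this]

theorem integral_segments_eq_of_integral_fderiv_eq_zero {E : Type*} [NormedAddCommGroup E]
    [NormedSpace ℝ E] [FiniteDimensional ℝ E] [MeasurableSpace E] [BorelSpace E]
    (hE : Module.finrank ℝ E = 2) {μ : Measure E} [μ.IsAddHaarMeasure] {A B C : E}
    (hABC : AffineIndependent ℝ ![B, A, C]) {g : E → ℝ} (hg : ContDiff ℝ 1 g) (P : E)
    (h : ∫ Q in convexHull ℝ {B, A, C}, fderiv ℝ g (P - Q) (C - B) ∂μ = 0) :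
    ∫ x in (0 : ℝ)..1, g (P - (B + x • (A - B))) =
      ∫ x in (0 : ℝ)..1, g (P - (C + x • (A - C))) := by
  let L : ℝ × ℝ →ₗ[ℝ] E :=
    (LinearMap.toSpanSingleton ℝ E (A - B)).coprod (LinearMap.toSpanSingleton ℝ E (C - B))
  have hL : Function.Injective L := by
    rw [← LinearMap.ker_eq_bot, LinearMap.ker_eq_bot']
    rintro ⟨s, t⟩ hst
    have key := affineIndependent_iff.1 hABC Finset.univ ![-(s + t), s, t]
      (by simp [Fin.sum_univ_three])
      (by
        rw [← hst]
        simp only [Fin.sum_univ_three, L, LinearMap.coprod_apply,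
          LinearMap.toSpanSingleton_apply, Matrix.cons_val]
        module)
    have h1 := key 1 (Finset.mem_univ _)
    have h2 := key 2 (Finset.mem_univ _)
    simp only [Matrix.cons_val] at h1 h2
    simp [h1, h2]
  let e : (ℝ × ℝ) ≃L[ℝ] E :=
    (LinearEquiv.ofInjectiveOfFinrankEq L hL (by simp [hE])).toContinuousLinearEquiv
  have he : ∀ p : ℝ × ℝ, e p = p.1 • (A - B) + p.2 • (C - B) := fun p => rfl
  let φ : (ℝ × ℝ) → E := fun p => B + e p
  have hφc : Continuous φ := continuous_const.add e.continuous
  have hφ : MeasurableEmbedding φ :=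
    (MeasurableEquiv.addLeft B).measurableEmbedding.comp
      e.toHomeomorph.measurableEmbedding
  have hmap : μ = (Measure.addHaarScalarFactor μ (volume.map e)) • Measure.map φ volume := by
    have h1 : Measure.map φ volume = Measure.map e volume := by
      rw [show φ = (fun x => B + x) ∘ e from rfl,
        ← Measure.map_map (measurable_const_add B) e.continuous.measurable, map_add_left_eq_self]
    rw [h1]
    exact Measure.isAddLeftInvariant_eq_smul _ _
  set c := Measure.addHaarScalarFactor μ (volume.map e)
  have hc0 : c ≠ 0 := by
    intro h0
    rw [h0, zero_smul] at hmap
    exact NeZero.ne μ hmap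
  have hpre : φ ⁻¹' (convexHull ℝ {B, A, C})
      = {p : ℝ × ℝ | 0 ≤ p.1 ∧ 0 ≤ p.2 ∧ p.1 + p.2 ≤ 1} := by
    ext ⟨x, y⟩
    rw [Set.mem_preimage, convexHull_triple_eq]
    constructor
    · rintro ⟨x', y', hx, hy, hxy, hQ⟩
      have : e (x, y) = e (x', y') := add_left_cancel hQ
      obtain ⟨rfl, rfl⟩ := Prod.ext_iff.1 (e.injective this)
      exact ⟨hx, hy, hxy⟩
    · rintro ⟨hx, hy, hxy⟩
      exact ⟨x, y, hx, hy, hxy, rfl⟩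
  rw [hmap, Measure.restrict_smul, integral_smul_nnreal_measure, hφ.setIntegral_map, hpre,
    smul_eq_zero, or_iff_right hc0] at h
  have hcf : Continuous (fderiv ℝ g) := hg.continuous_fderiv one_ne_zero
  have hsimp := integral_deriv_simplex (H := fun x y => - g (P - φ (x, y)))
    (H' := fun x y => fderiv ℝ g (P - φ (x, y)) (C - B))
    ((hcf.comp (by fun_prop)).clm_apply continuous_const) (fun x y => by
      have h1 : HasDerivAt (fun y => P - φ (x, y)) (-(C - B)) y := by
        simp only [φ, he]
        have := ((((hasDerivAt_id y).smul_const (C - B)).const_add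
          (x • (A - B))).const_add B).const_sub P
        simpa using this
      have := ((hg.differentiable one_ne_zero _).hasFDerivAt.comp_hasDerivAt y h1).neg
      simpa [Function.comp_def, Pi.neg_def] using this)
  rw [h] at hsimp
  have hgc := hg.continuous
  rw [intervalIntegral.integral_sub (Continuous.intervalIntegrable (by fun_prop) _ _)
    (Continuous.intervalIntegrable (by fun_prop) _ _),
    intervalIntegral.integral_neg, intervalIntegral.integral_neg] at hsimp
  have h1 : ∀ x : ℝ, φ (x, 1 - x) = C + x • (A - C) := fun x => by
    simp only [φ, he]; module
  have h2 : ∀ x : ℝ, φ (x, 0) = B + x • (A - B) := fun x => by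
    simp only [φ, he]; module
  simp only [h1, h2] at hsimp
  linarith

theorem not_collinear_of_mem_interior_convexHull {E : Type*} [NormedAddCommGroup E]
    [NormedSpace ℝ E] [FiniteDimensional ℝ E] (hE : Module.finrank ℝ E = 2) {A B C P : E}
    (hABC : AffineIndependent ℝ ![A, B, C]) (hP : P ∈ interior (convexHull ℝ {A, B, C})) :
    ¬ Collinear ℝ {A, B, P} := by
  intro hcol
  let b : AffineBasis (Fin 3) ℝ E := ⟨![A, B, C], hABC,
    (hABC.affineSpan_eq_top_iff_card_eq_finrank_add_one).2 (by simp [hE])⟩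
  have hb : Set.range b = {A, B, C} := by
    change Set.range ![A, B, C] = _
    ext; simp [or_comm, or_left_comm, eq_comm]
  have hA : b.coord 2 A = 0 := b.coord_apply_ne (i := 2) (j := 0) (by decide)
  have hB : b.coord 2 B = 0 := b.coord_apply_ne (i := 2) (j := 1) (by decide)
  rw [← hb, b.interior_convexHull] at hP
  have hAB : A ≠ B := by
    have := hABC.injective.ne (show (0 : Fin 3) ≠ 1 by decide)
    simpa using this
  have hmem := hcol.mem_affineSpan_of_mem_of_ne (p₁ := A) (p₂ := B) (p₃ := P) (by simp) (by simp)
    (by simp) hAB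
  obtain ⟨t, rfl⟩ := mem_affineSpan_pair_iff_exists_lineMap_eq.1 hmem
  have := hP 2
  rw [AffineMap.apply_lineMap, hA, hB] at this
  simp at this

theorem sin_cos_half_angle_pos {E : Type*} [NormedAddCommGroup E] [InnerProductSpace ℝ E]
    {X Y Z : E} (h : ¬ Collinear ℝ {X, Y, Z}) :
    0 < Real.sin (∠ X Y Z / 2) ∧ 0 < Real.cos (∠ X Y Z / 2) := by
  have hs := sin_pos_of_not_collinear h
  have h0 : ∠ X Y Z ≠ 0 := fun h' => by simp [h'] at hs
  have hπ : ∠ X Y Z ≠ π := fun h' => by simp [h'] at hs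
  have := lt_of_le_of_ne (angle_nonneg X Y Z) h0.symm
  have := lt_of_le_of_ne (angle_le_pi X Y Z) hπ
  exact ⟨Real.sin_pos_of_pos_of_lt_pi (by linarith) (by linarith),
    Real.cos_pos_of_mem_Ioo ⟨by linarith, by linarith⟩⟩

theorem integral_inv_dist_segment {E : Type*} [NormedAddCommGroup E]
    [InnerProductSpace ℝ E] {A B P : E} (h : ¬ Collinear ℝ {B, A, P}) :
    dist A B * ∫ x in (0 : ℝ)..1, ‖P - (B + x • (A - B))‖⁻¹ =
      - Real.log (Real.tan (∠ A B P / 2) * Real.tan (∠ P A B / 2)) := by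
  have hAB : A ≠ B := fun h' => h (by simp [h', collinear_pair])
  have hPA : P ≠ A := fun h' => h (by simp [h', collinear_pair])
  have hPB : P ≠ B := fun h' => h (by simp [h', collinear_pair])
  set d := A - B with hd
  have hd0 : 0 < ‖d‖ := norm_pos_iff.2 (sub_ne_zero.2 hAB)
  let w : ℝ → E := fun x => B + x • d - P
  have hline : ∀ t : ℝ, P ≠ B + t • d := by
    intro t ht
    apply h
    have : P = AffineMap.lineMap B A t := by
      rw [AffineMap.lineMap_apply, vsub_eq_sub, vadd_eq_add, add_comm, ← hd, ht]
    have := collinear_insert_of_mem_affineSpan_pair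
      (this ▸ AffineMap.lineMap_mem_affineSpan_pair t B A)
    rwa [Set.insert_comm, Set.pair_comm P A] at this
  have hw0 : ∀ x, w x ≠ 0 := fun x hx => hline x (sub_eq_zero.1 hx).symm
  have hpos : ∀ x, 0 < ‖d‖ * ‖w x‖ + inner ℝ (w x) d := by
    intro x
    have h1 := real_inner_le_norm (-(w x)) d
    have h2 : inner ℝ (-(w x)) d ≠ ‖-(w x)‖ * ‖d‖ := by
      rw [Ne, inner_eq_norm_mul_iff_real]
      intro h3
      refine hline (x + ‖w x‖ / ‖d‖) ?_
      have h4 : -(w x) = (‖w x‖ / ‖d‖) • d := by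
        rw [norm_neg] at h3
        rw [div_eq_inv_mul, mul_smul, ← h3, inv_smul_smul₀ hd0.ne']
      rw [add_smul, ← h4]
      simp only [w]
      module
    have h3 := lt_of_le_of_ne h1 h2
    rw [norm_neg, inner_neg_left] at h3
    linarith
  have hderiv : ∀ x, HasDerivAt (fun x => Real.log (‖d‖ * ‖w x‖ + inner ℝ (w x) d))
      (‖d‖ * ‖w x‖⁻¹) x := by
    intro x
    have hw : HasDerivAt w d x := by
      have := (((hasDerivAt_id x).smul_const d).const_add B).sub_const P
      simpa [w] using this
    have hn : HasDerivAt (fun x => ‖w x‖) (inner ℝ (w x) d / ‖w x‖) x := by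
      have := hw.norm_sq.sqrt (by simpa using hw0 x)
      simp only [Real.sqrt_sq (norm_nonneg _)] at this
      convert! this using 1
      ring
    have hi : HasDerivAt (fun x => inner ℝ (w x) d) (‖d‖ ^ 2) x := by
      have := hw.inner ℝ (hasDerivAt_const x d)
      simpa using this
    have := ((hn.const_mul ‖d‖).add hi).log (hpos x).ne'
    convert! this using 1
    have h1 := (hpos x).ne'
    have h2 : ‖w x‖ ≠ 0 := norm_ne_zero_iff.2 (hw0 x)
    simp only [Pi.add_apply]
    field_simp
    ring
  have hcont : Continuous fun x => ‖d‖ * ‖w x‖⁻¹ := by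
    have : Continuous w := by fun_prop
    exact continuous_const.mul (this.norm.inv₀ fun x => norm_ne_zero_iff.2 (hw0 x))
  have hI := intervalIntegral.integral_eq_sub_of_hasDerivAt (fun x _ => hderiv x)
    (hcont.intervalIntegrable 0 1)
  rw [intervalIntegral.integral_const_mul] at hI
  have hcongr : ∀ x, ‖P - (B + x • d)‖ = ‖w x‖ := fun x => norm_sub_rev _ _
  simp only [hcongr]
  rw [dist_eq_norm, ← hd, hI]
  have e0 : ‖d‖ * ‖w 0‖ + inner ℝ (w 0) d = ‖d‖ * dist P B * (1 - Real.cos (∠ A B P)) := by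
    have h1 : w 0 = -(P - B) := by simp [w]
    have h2 := InnerProductGeometry.cos_angle_mul_norm_mul_norm (A - B) (P - B)
    rw [real_inner_comm] at h2
    rw [h1, inner_neg_left, norm_neg, ← h2, dist_eq_norm]
    simp only [EuclideanGeometry.angle, vsub_eq_sub, hd]
    ring
  have e1 : ‖d‖ * ‖w 1‖ + inner ℝ (w 1) d = ‖d‖ * dist P A * (1 + Real.cos (∠ P A B)) := by
    have h1 : w 1 = -(P - A) := by simp [w, hd]
    have h2 := InnerProductGeometry.cos_angle_mul_norm_mul_norm (P - A) (B - A)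
    rw [h1, norm_neg, hd, ← neg_sub B A, inner_neg_neg, ← h2, dist_eq_norm, norm_neg]
    simp only [EuclideanGeometry.angle, vsub_eq_sub]
    ring
  have p0 := hpos 0
  have p1 := hpos 1
  rw [← Real.log_div p1.ne' p0.ne', ← Real.log_inv]
  rw [e0] at p0
  rw [e1] at p1
  rw [e0, e1]
  congr 1
  have hsin := law_sin A B P
  obtain ⟨s1, c1⟩ := sin_cos_half_angle_pos (X := A) (Y := B) (Z := P) (by rwa [Set.insert_comm])
  obtain ⟨s2, c2⟩ := sin_cos_half_angle_pos (X := P) (Y := A) (Z := B)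
    (by rwa [Set.pair_comm, Set.insert_comm, Set.pair_comm P])
  have q1 : Real.sin (∠ A B P) = 2 * Real.sin (∠ A B P / 2) * Real.cos (∠ A B P / 2) := by
    rw [← Real.sin_two_mul]; ring_nf
  have q2 : Real.sin (∠ P A B) = 2 * Real.sin (∠ P A B / 2) * Real.cos (∠ P A B / 2) := by
    rw [← Real.sin_two_mul]; ring_nf
  have q3 : 1 - Real.cos (∠ A B P) = 2 * Real.sin (∠ A B P / 2) ^ 2 := by
    rw [Real.sin_sq_eq_half_sub]; ring_nf
  have q4 : 1 + Real.cos (∠ P A B) = 2 * Real.cos (∠ P A B / 2) ^ 2 := by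
    rw [Real.cos_sq]; ring_nf
  rw [q1, q2, dist_comm B P] at hsin
  rw [q3, q4, Real.tan_eq_sin_div_cos, Real.tan_eq_sin_div_cos]
  have : dist P B ≠ 0 := dist_ne_zero.2 hPB
  field_simp
  linear_combination (-1/2) * hsin

/-- At a stationary point, the logarithmic potentials of the two sides through `A` are
proportional to the side lengths. -/
theorem log_div_dist_eq_of_gradient_eq_zero {A B C P : EuclideanSpace ℝ (Fin 2)}
    (hABC : ¬ Collinear ℝ {B, A, C}) (hP : P ∈ interior (convexHull ℝ {B, A, C}))
    (hgrad : gradient (fun P => ∫ Q in convexHull ℝ {B, A, C}, (dist P Q)⁻¹) P = 0) :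
    Real.log (Real.tan (∠ A B P / 2) * Real.tan (∠ P A B / 2)) / dist A B =
      Real.log (Real.tan (∠ A C P / 2) * Real.tan (∠ P A C / 2)) / dist A C := by
  have hE : Module.finrank ℝ (EuclideanSpace ℝ (Fin 2)) = 2 := by simp
  have hABC' := affineIndependent_iff_not_collinear_set.2 hABC
  have hCAB : ({C, A, B} : Set (EuclideanSpace ℝ (Fin 2))) = {B, A, C} := by grind
  have hCAB' : AffineIndependent ℝ ![C, A, B] :=
    affineIndependent_iff_not_collinear_set.2 (by rwa [hCAB])
  have hncB : ∀ Q ∈ interior (convexHull ℝ {B, A, C}), ¬ Collinear ℝ {B, A, Q} :=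
    fun Q hQ => not_collinear_of_mem_interior_convexHull hE hABC' hQ
  have hncC : ∀ Q ∈ interior (convexHull ℝ {B, A, C}), ¬ Collinear ℝ {C, A, Q} :=
    fun Q hQ => not_collinear_of_mem_interior_convexHull hE hCAB' (by rwa [hCAB])
  have hTc : IsCompact (convexHull ℝ ({B, A, C} : Set (EuclideanSpace ℝ (Fin 2)))) :=
    (Set.toFinite _).isCompact_convexHull (𝕜 := ℝ)
  obtain ⟨r, hr, hball⟩ := Metric.isOpen_iff.1 isOpen_interior P hP
  obtain ⟨g, hg, hgr, c, hc⟩ := exists_contDiff_kernel hE.ge (μ := volume) hTc hr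
    (hball.trans interior_subset)
  have hder := ((hasFDerivAt_setIntegral_sub_of_contDiff (μ := volume) hTc hg P).const_add
    c).congr_of_eventuallyEq hc
  simp only [← dist_eq_norm] at hder
  have hzero := inner_gradient_left (𝕜 := ℝ) (y := C - B)
    (f := fun P => ∫ Q in convexHull ℝ {B, A, C}, (dist P Q)⁻¹) (x := P)
  have hint : Integrable (fun Q => fderiv ℝ g (P - Q))
      (volume.restrict (convexHull ℝ {B, A, C})) :=
    ((hg.continuous_fderiv one_ne_zero).comp
      (by fun_prop : Continuous fun Q => P - Q)).continuousOn.integrableOn_compact hTc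
  rw [hgrad, inner_zero_left, hder.fderiv, ContinuousLinearMap.integral_apply hint] at hzero
  have hseg := integral_segments_eq_of_integral_fderiv_eq_zero hE hABC' hg P hzero.symm
  have hfar : ∀ D, (∀ Q ∈ interior (convexHull ℝ {B, A, C}), ¬ Collinear ℝ {D, A, Q}) →
      ∀ x : ℝ, g (P - (D + x • (A - D))) = ‖P - (D + x • (A - D))‖⁻¹ := by
    intro D hD x
    refine hgr _ ?_
    by_contra! hlt
    refine hD _ (hball (a := D + x • (A - D)) ?_) ?_
    · rwa [Metric.mem_ball, dist_comm, dist_eq_norm]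
    · rw [Set.pair_comm, Set.insert_comm]
      apply collinear_insert_of_mem_affineSpan_pair
      convert AffineMap.lineMap_mem_affineSpan_pair x D A using 1
      rw [AffineMap.lineMap_apply, vsub_eq_sub, vadd_eq_add, add_comm]
  simp only [hfar B hncB, hfar C hncC] at hseg
  have hB := integral_inv_dist_segment (hncB P hP)
  have hC := integral_inv_dist_segment (hncC P hP)
  rw [← hseg] at hC
  have hAB : dist A B ≠ 0 := dist_ne_zero.2 fun h' => hABC (by simp [h', collinear_pair])
  have hAC : dist A C ≠ 0 := dist_ne_zero.2 fun h' => hABC (by simp [h', collinear_pair])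
  rw [div_eq_div_iff hAB hAC]
  linear_combination dist A C * hB - dist A B * hC

theorem rpow_one_div_eq_of_log_div_eq {X Y a b s t : ℝ} (hX : 0 < X) (hY : 0 < Y) (ha : a ≠ 0)
    (hb : b ≠ 0) (hs : s ≠ 0) (ht : t ≠ 0) (hst : s * b = t * a)
    (h : Real.log X / a = Real.log Y / b) : X ^ (1 / s) = Y ^ (1 / t) := by
  rw [Real.rpow_def_of_pos hX, Real.rpow_def_of_pos hY]
  congr 1
  field_simp at h ⊢
  have : (Real.log X * t - Real.log Y * s) * a = 0 := by
    linear_combination s * h - Real.log X * hst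
  exact sub_eq_zero.1 ((mul_eq_zero.1 this).resolve_right ha)

theorem rpow_eq_of_gradient_eq_zero {A B C P : EuclideanSpace ℝ (Fin 2)}
    (hABC : ¬ Collinear ℝ {A, B, C}) (hP : P ∈ interior (convexHull ℝ {A, B, C}))
    (hgrad : gradient (fun P => ∫ Q in convexHull ℝ {A, B, C}, (dist P Q)⁻¹) P = 0) :
    (Real.tan (∠ A B P / 2) * Real.tan (∠ P A B / 2)) ^ (1 / Real.sin (∠ A C B)) =
      (Real.tan (∠ A C P / 2) * Real.tan (∠ P A C / 2)) ^ (1 / Real.sin (∠ A B C)) := by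
  have hE : Module.finrank ℝ (EuclideanSpace ℝ (Fin 2)) = 2 := by simp
  have hACB : ¬ Collinear ℝ {A, C, B} := by rwa [Set.pair_comm]
  have hB := not_collinear_of_mem_interior_convexHull hE
    (affineIndependent_iff_not_collinear_set.2 hABC) hP
  have hC := not_collinear_of_mem_interior_convexHull hE
    (affineIndependent_iff_not_collinear_set.2 hACB) (by rwa [Set.pair_comm])
  have htan : ∀ {D}, ¬ Collinear ℝ {A, D, P} →
      0 < Real.tan (∠ A D P / 2) * Real.tan (∠ P A D / 2) := by
    intro D hD
    obtain ⟨s1, c1⟩ := sin_cos_half_angle_pos hD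
    obtain ⟨s2, c2⟩ := sin_cos_half_angle_pos (X := P) (Y := A) (Z := D)
      (by rwa [Set.insert_comm, Set.pair_comm])
    rw [Real.tan_eq_sin_div_cos, Real.tan_eq_sin_div_cos]
    positivity
  have hsin := law_sin C B A
  rw [angle_comm C B A, dist_comm B A] at hsin
  refine rpow_one_div_eq_of_log_div_eq (htan hB) (htan hC)
    (dist_ne_zero.2 fun h => hABC (by simp [h, collinear_pair]))
    (dist_ne_zero.2 fun h => hABC (by simp [h, collinear_pair]))
    (sin_pos_of_not_collinear hACB).ne' (sin_pos_of_not_collinear hABC).ne' hsin.symm ?_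
  rw [Set.insert_comm] at hABC hP hgrad
  exact log_div_dist_eq_of_gradient_eq_zero hABC hP hgrad

theorem stationary_point_angle_relation
    (A B C : EuclideanSpace ℝ (Fin 2))
    (hABC : AffineIndependent ℝ ![A, B, C])
    (T : Set (EuclideanSpace ℝ (Fin 2)))
    (hT : T = convexHull ℝ {A, B, C})
    (V : EuclideanSpace ℝ (Fin 2) → ℝ)
    (hV : ∀ P, V P = ∫ Q in T, (dist P Q)⁻¹ ∂volume)
    (P : EuclideanSpace ℝ (Fin 2)) (hP : P ∈ interior T)
    (hgrad : gradient V P = 0)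
    (α β γ α₁ α₂ β₁ β₂ γ₁ γ₂ : ℝ)
    (hα : α = ∠ B A C) (hβ : β = ∠ C B A) (hγ : γ = ∠ A C B)
    (hα₁ : α₁ = ∠ B A P) (hα₂ : α₂ = ∠ P A C)
    (hβ₁ : β₁ = ∠ C B P) (hβ₂ : β₂ = ∠ P B A)
    (hγ₁ : γ₁ = ∠ A C P) (hγ₂ : γ₂ = ∠ P C B) :
    (Real.tan (β₁ / 2) * Real.tan (γ₂ / 2)) ^ (1 / Real.sin α : ℝ)
      = (Real.tan (γ₁ / 2) * Real.tan (α₂ / 2)) ^ (1 / Real.sin β : ℝ) ∧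
    (Real.tan (γ₁ / 2) * Real.tan (α₂ / 2)) ^ (1 / Real.sin β : ℝ)
      = (Real.tan (α₁ / 2) * Real.tan (β₂ / 2)) ^ (1 / Real.sin γ : ℝ) := by
  subst hT hα hβ hγ hα₁ hα₂ hβ₁ hβ₂ hγ₁ hγ₂
  obtain rfl : V = _ := funext hV
  have hnc := affineIndependent_iff_not_collinear_set.1 hABC
  have hCBA : ({A, B, C} : Set (EuclideanSpace ℝ (Fin 2))) = {C, B, A} := by grind
  have hACB : ({A, B, C} : Set (EuclideanSpace ℝ (Fin 2))) = {A, C, B} := by grind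
  have relC := rpow_eq_of_gradient_eq_zero (hCBA ▸ hnc) (hCBA ▸ hP) (hCBA ▸ hgrad)
  have relA := rpow_eq_of_gradient_eq_zero (hACB ▸ hnc) (hACB ▸ hP) (hACB ▸ hgrad)
  rw [angle_comm C A B, angle_comm C A P, angle_comm P C A, mul_comm (Real.tan (∠ P A C / 2))]
    at relC
  rw [angle_comm A B C, angle_comm A B P, angle_comm P A B, mul_comm (Real.tan (∠ P B A / 2))]
    at relA
  exact ⟨relC, relA⟩
end

section
/- Half-angle product identity: if A, B, P are three points of the Euclidean plane that are not collinear, then tan(∠ B A P / 2) · tan(∠ A B P / 2) = (dist P A + dist P B − dist A B)/(dist P A + dist P B + dist A B). -/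
open EuclideanGeometry

/-- The half-angle formula for the tangent, which holds for every real `x` because
`Real.tan` vanishes where the cosine does. -/
theorem Real.tan_div_two_eq_sin_div_one_add_cos (x : ℝ) :
    Real.tan (x / 2) = Real.sin x / (1 + Real.cos x) := by
  have hs : Real.sin x = 2 * Real.sin (x / 2) * Real.cos (x / 2) := by
    rw [← Real.sin_two_mul, mul_div_cancel₀ x two_ne_zero]
  have hc : 1 + Real.cos x = 2 * Real.cos (x / 2) * Real.cos (x / 2) := by
    have := Real.cos_sq (x / 2)
    rw [mul_div_cancel₀ x two_ne_zero] at this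
    linarith
  rw [hs, hc, Real.tan_eq_sin_div_cos]
  by_cases h : Real.cos (x / 2) = 0
  · simp [h]
  · field_simp

theorem Real.one_add_cos_pos_of_sin_pos {x : ℝ} (h : 0 < Real.sin x) : 0 < 1 + Real.cos x := by
  nlinarith [Real.sin_sq_add_cos_sq x, Real.neg_one_le_cos x]

theorem half_angle_product_identity
    (A B P : EuclideanSpace ℝ (Fin 2))
    (h : ¬ Collinear ℝ ({A, B, P} : Set (EuclideanSpace ℝ (Fin 2)))) :
    Real.tan (∠ B A P / 2) * Real.tan (∠ A B P / 2)
      = (dist P A + dist P B - dist A B) / (dist P A + dist P B + dist A B) := by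
  have hA : 0 < 1 + Real.cos (∠ B A P) :=
    Real.one_add_cos_pos_of_sin_pos
      (sin_pos_of_not_collinear (by rwa [Set.insert_comm]))
  have hB : 0 < 1 + Real.cos (∠ A B P) :=
    Real.one_add_cos_pos_of_sin_pos (sin_pos_of_not_collinear h)
  have ha : 0 < dist P B := dist_pos.2 (ne₂₃_of_not_collinear h).symm
  have hb : 0 < dist P A := dist_pos.2 (ne₁₃_of_not_collinear h).symm
  have hc : 0 < dist A B := dist_pos.2 (ne₁₂_of_not_collinear h)
  have cosA := law_cos B A P
  have cosB := law_cos A B P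
  have sines : Real.sin (∠ A B P) * dist P B = Real.sin (∠ B A P) * dist P A := by
    simpa only [angle_comm P A B, dist_comm B P] using
      sin_angle_mul_dist_eq_sin_angle_mul_dist A B P
  have sqA := Real.sin_sq_add_cos_sq (∠ B A P)
  rw [Real.tan_div_two_eq_sin_div_one_add_cos, Real.tan_div_two_eq_sin_div_one_add_cos]
  rw [dist_comm B P, dist_comm B A] at cosA
  rw [dist_comm A P] at cosB
  generalize Real.sin (∠ B A P) = s at *
  generalize Real.sin (∠ A B P) = t at *
  generalize Real.cos (∠ B A P) = u at *
  generalize Real.cos (∠ A B P) = v at *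
  generalize dist P B = a at *
  generalize dist P A = b at *
  generalize dist A B = c at *
  have hu : 2 * c * (b * (1 - u)) = (a - b + c) * (a + b - c) := by linarith
  have hv : 2 * c * (a * (1 + v)) = (a - b + c) * (a + b + c) := by linarith
  have hst : a * (s * t) = b * ((1 - u) * (1 + u)) := by
    linear_combination s * sines + b * sqA
  have hne : a - b + c ≠ 0 := by
    intro h0
    rw [h0, zero_mul] at hv
    exact absurd hv (by positivity)
  calc s / (1 + u) * (t / (1 + v)) = a * (s * t) / (a * ((1 + u) * (1 + v))) := by field_simp
    _ = 2 * c * (b * (1 - u)) / (2 * c * (a * (1 + v))) := by rw [hst]; field_simp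
    _ = (b + a - c) / (b + a + c) := by
      rw [hu, hv, mul_div_mul_left _ _ hne, add_comm b a]
end

section
/- Heron-type identity for an interior point: let P be a point in the interior of the triangle T, and set a = dist B C, b = dist C A, c = dist A B, u = dist P B + dist P C, v = dist P C + dist P A, w = dist P A + dist P B. Then Real.sqrt((u² − a²)·(a² − (v − w)²)) + Real.sqrt((v² − b²)·(b² − (w − u)²)) + Real.sqrt((w² − c²)·(c² − (u − v)²)) = Real.sqrt(2·(a²b² + b²c² + c²a²) − (a⁴ + b⁴ + c⁴)). -/
/-- The cross product of the plane vectors `Y - X` and `Z - X`. -/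
def planeCross (X Y Z : EuclideanSpace ℝ (Fin 2)) : ℝ :=
  (Y 0 - X 0) * (Z 1 - X 1) - (Y 1 - X 1) * (Z 0 - X 0)

theorem sq_dist_plane (X Y : EuclideanSpace ℝ (Fin 2)) :
    dist X Y ^ 2 = (X 0 - Y 0) ^ 2 + (X 1 - Y 1) ^ 2 := by
  rw [EuclideanSpace.dist_eq, Real.sq_sqrt (by positivity)]
  simp [Fin.sum_univ_two, Real.dist_eq, sq_abs]

theorem heron_plane (X Y Z : EuclideanSpace ℝ (Fin 2)) :
    ((dist X Y + dist X Z) ^ 2 - dist Y Z ^ 2) * (dist Y Z ^ 2 - (dist X Z - dist X Y) ^ 2)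
      = (2 * planeCross X Y Z) ^ 2 := by
  have expand (p q r : ℝ) : ((p + q) ^ 2 - r) * (r - (q - p) ^ 2)
      = 4 * (p ^ 2 * q ^ 2) - (p ^ 2 + q ^ 2 - r) ^ 2 := by ring
  rw [expand, sq_dist_plane X Y, sq_dist_plane X Z, sq_dist_plane Y Z, planeCross]
  ring

theorem mem_convexHull_triple {A B C P : EuclideanSpace ℝ (Fin 2)}
    (hP : P ∈ convexHull ℝ {A, B, C}) :
    ∃ α β γ : ℝ, 0 ≤ α ∧ 0 ≤ β ∧ 0 ≤ γ ∧ α + β + γ = 1 ∧ P = α • A + β • B + γ • C := by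
  rw [convexHull_insert (Set.insert_nonempty _ _), convexHull_pair,
    convexJoin_singleton_left] at hP
  simp only [Set.mem_iUnion] at hP
  obtain ⟨Q, ⟨s, t, hs, ht, hst, rfl⟩, ⟨p, q, hp, hq, hpq, rfl⟩⟩ := hP
  refine ⟨p, q * s, q * t, hp, mul_nonneg hq hs, mul_nonneg hq ht, ?_, ?_⟩
  · rw [add_assoc, ← mul_add, hst, mul_one, hpq]
  · simp only [smul_add, smul_smul, add_assoc]


theorem heron_identity_interior_point
    (A B C : EuclideanSpace ℝ (Fin 2))
    (hABC : AffineIndependent ℝ ![A, B, C])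
    (T : Set (EuclideanSpace ℝ (Fin 2)))
    (hT : T = convexHull ℝ {A, B, C})
    (P : EuclideanSpace ℝ (Fin 2)) (hP : P ∈ interior T)
    (a b c u v w : ℝ)
    (ha : a = dist B C) (hb : b = dist C A) (hc : c = dist A B)
    (hu : u = dist P B + dist P C) (hv : v = dist P C + dist P A)
    (hw : w = dist P A + dist P B) :
    Real.sqrt ((u ^ 2 - a ^ 2) * (a ^ 2 - (v - w) ^ 2))
      + Real.sqrt ((v ^ 2 - b ^ 2) * (b ^ 2 - (w - u) ^ 2))
      + Real.sqrt ((w ^ 2 - c ^ 2) * (c ^ 2 - (u - v) ^ 2))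
      = Real.sqrt (2 * (a ^ 2 * b ^ 2 + b ^ 2 * c ^ 2 + c ^ 2 * a ^ 2)
          - (a ^ 4 + b ^ 4 + c ^ 4)) := by
  obtain ⟨α, β, γ, hα, hβ, hγ, hsum, hPeq⟩ :=
    mem_convexHull_triple (hT ▸ interior_subset hP)
  have h0 : P 0 = α * A 0 + β * B 0 + γ * C 0 := by simp [hPeq]
  have h1 : P 1 = α * A 1 + β * B 1 + γ * C 1 := by simp [hPeq]
  obtain rfl : α = 1 - β - γ := by linarith
  have hA : planeCross P B C = (1 - β - γ) * planeCross A B C := by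
    simp only [planeCross, h0, h1]; ring
  have hB : planeCross P C A = β * planeCross A B C := by
    simp only [planeCross, h0, h1]; ring
  have hC : planeCross P A B = γ * planeCross A B C := by
    simp only [planeCross, h0, h1]; ring
  have eA : (u ^ 2 - a ^ 2) * (a ^ 2 - (v - w) ^ 2) = (2 * planeCross P B C) ^ 2 := by
    rw [← heron_plane, ha, hu, hv, hw]; ring
  have eB : (v ^ 2 - b ^ 2) * (b ^ 2 - (w - u) ^ 2) = (2 * planeCross P C A) ^ 2 := by
    rw [← heron_plane, hb, hu, hv, hw]; ring
  have eC : (w ^ 2 - c ^ 2) * (c ^ 2 - (u - v) ^ 2) = (2 * planeCross P A B) ^ 2 := by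
    rw [← heron_plane, hc, hu, hv, hw]; ring
  have eT : 2 * (a ^ 2 * b ^ 2 + b ^ 2 * c ^ 2 + c ^ 2 * a ^ 2) - (a ^ 4 + b ^ 4 + c ^ 4)
      = (2 * planeCross A B C) ^ 2 := by
    rw [← heron_plane, ha, hb, hc, dist_comm C A]; ring
  rw [eA, eB, eC, eT]
  simp only [Real.sqrt_sq_eq_abs, hA, hB, hC, abs_mul, abs_of_nonneg hα, abs_of_nonneg hβ,
    abs_of_nonneg hγ]
  ring
end

section
/- Theorem 2 (distance form): if P is a point in the interior of the triangle T with gradient V P = 0, then there exists λ > 0 such that, setting u = a · coth(a·λ/(a+b+c)), v = b · coth(b·λ/(a+b+c)), w = c · coth(c·λ/(a+b+c)) (where coth x = cosh x / sinh x), one has dist P A = (v + w − u)/2, dist P B = (w + u − v)/2, and dist P C = (u + v − w)/2 (so that dist P B + dist P C = u, dist P C + dist P A = v, dist P A + dist P B = w). -/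
open MeasureTheory

namespace TrianglePotential

open Set

/-- The Euclidean plane. -/
local notation "𝔼" => EuclideanSpace ℝ (Fin 2)

/-- The oriented area of the parallelogram spanned by two plane vectors. -/
def cross (x y : 𝔼) : ℝ := x 0 * y 1 - x 1 * y 0

/-- The integral of the inverse distance to a point along a segment of length `a`, whose endpoints
lie at distances `r` and `s` from that point. -/
noncomputable def segmentPotential (r s a : ℝ) : ℝ :=
  (Real.log (r + s + a) - Real.log (r + s - a)) / a

lemma norm_sq_eq (x : 𝔼) : ‖x‖ ^ 2 = x 0 ^ 2 + x 1 ^ 2 := by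
  simp [EuclideanSpace.norm_sq_eq]

lemma cross_sq_add_inner_sq (x y : 𝔼) :
    cross x y ^ 2 + (x 0 * y 0 + x 1 * y 1) ^ 2 = (‖x‖ * ‖y‖) ^ 2 := by
  rw [mul_pow, norm_sq_eq, norm_sq_eq, cross]; ring

lemma abs_inner_lt_of_cross_ne_zero {x y : 𝔼} (h : cross x y ≠ 0) :
    |x 0 * y 0 + x 1 * y 1| < ‖x‖ * ‖y‖ := by
  apply abs_lt_of_sq_lt_sq _ (by positivity)
  nlinarith [cross_sq_add_inner_sq x y, pow_pos (abs_pos.2 h) 2, sq_abs (cross x y)]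

lemma ne_zero_of_cross_ne_zero {x y : 𝔼} (h : cross x y ≠ 0) : x ≠ 0 ∧ y ≠ 0 ∧ y - x ≠ 0 := by
  refine ⟨?_, ?_, fun h' => ?_⟩
  · rintro rfl; simp [cross] at h
  · rintro rfl; simp [cross] at h
  · rw [sub_eq_zero.1 h'] at h; simp [cross] at h; exact h (by ring)

lemma norm_sub_sq_eq (x y : 𝔼) :
    ‖y - x‖ ^ 2 = ‖x‖ ^ 2 + ‖y‖ ^ 2 - 2 * (x 0 * y 0 + x 1 * y 1) := by
  simp only [norm_sq_eq, PiLp.sub_apply]; ring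

lemma norm_sub_lt_of_cross_ne_zero {x y : 𝔼} (h : cross x y ≠ 0) : ‖y - x‖ < ‖x‖ + ‖y‖ := by
  apply lt_of_pow_lt_pow_left₀ 2 (by positivity)
  rw [norm_sub_sq_eq]
  nlinarith [abs_lt.1 (abs_inner_lt_of_cross_ne_zero h)]

lemma integral_inv_norm_segment {x y : 𝔼} (h : cross x y ≠ 0) :
    ∫ s in (0 : ℝ)..1, ‖x + s • (y - x)‖⁻¹ = segmentPotential ‖x‖ ‖y‖ ‖y - x‖ := by
  obtain ⟨hx, hy, hxy⟩ := ne_zero_of_cross_ne_zero h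
  have hcr : ∀ s : ℝ, cross (x + s • (y - x)) (y - x) ≠ 0 := fun s => by
    convert h using 1; simp [cross]; ring
  have hne : ∀ s : ℝ, x + s • (y - x) ≠ 0 := fun s => (ne_zero_of_cross_ne_zero (hcr s)).1
  set a := ‖y - x‖ with ha
  have ha0 : 0 < a := norm_pos_iff.2 hxy
  have hpos : ∀ s : ℝ, 0 < a * ‖x + s • (y - x)‖ + inner ℝ (x + s • (y - x)) (y - x) := fun s => by
    have := abs_lt.1 (abs_inner_lt_of_cross_ne_zero (hcr s))
    simp only [PiLp.inner_apply, Fin.sum_univ_two, RCLike.inner_apply, conj_trivial]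
    nlinarith
  have hd : ∀ s : ℝ, HasDerivAt (fun s : ℝ =>
      Real.log (a * ‖x + s • (y - x)‖ + inner ℝ (x + s • (y - x)) (y - x)) / a)
      ‖x + s • (y - x)‖⁻¹ s := fun s => by
    have h1 : HasDerivAt (fun s : ℝ => x + s • (y - x)) (y - x) s := by
      simpa using ((hasDerivAt_id s).smul_const (y - x)).const_add x
    have h2 : HasDerivAt (fun s : ℝ => ‖x + s • (y - x)‖)
        (inner ℝ (x + s • (y - x)) (y - x) / ‖x + s • (y - x)‖) s := by
      have h3 := (h1.norm_sq).sqrt (pow_ne_zero 2 (norm_ne_zero_iff.2 (hne s)))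
      simp only [Real.sqrt_sq (norm_nonneg _)] at h3
      convert h3 using 1
      field_simp
    have h4 : HasDerivAt (fun s : ℝ => inner ℝ (x + s • (y - x)) (y - x)) (a ^ 2) s := by
      have := h1.inner ℝ (hasDerivAt_const s (y - x))
      simpa [ha] using this
    have h5 := (((h2.const_mul a).add h4).log (hpos s).ne').div_const a
    refine h5.congr_deriv ?_
    have := norm_ne_zero_iff.2 (hne s)
    have h6 := (hpos s).ne'
    change _ / (a * ‖x + s • (y - x)‖ + inner ℝ (x + s • (y - x)) (y - x)) / a = _
    field_simp
    ring
  rw [intervalIntegral.integral_eq_sub_of_hasDerivAt (fun s _ => hd s)]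
  · have e1 := hpos 1
    have e0 := hpos 0
    have hq := norm_sub_sq_eq x y
    have hlt := norm_sub_lt_of_cross_ne_zero h
    have n1 := norm_sq_eq x
    have n2 := norm_sq_eq y
    rw [← ha] at hq hlt
    simp only [one_smul, zero_smul, add_zero, add_sub_cancel, PiLp.inner_apply, Fin.sum_univ_two,
      RCLike.inner_apply, conj_trivial, PiLp.sub_apply] at e1 e0 ⊢
    rw [segmentPotential, ← sub_div, ← Real.log_div e1.ne' e0.ne', ← Real.log_div (by positivity)
      (by linarith)]
    congr 2
    rw [div_eq_div_iff e0.ne' (by linarith)]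
    linear_combination -(‖x‖ + ‖y‖) * hq - (‖x‖ + ‖y‖ - a) * n2 - (‖x‖ + ‖y‖ + a) * n1
  · exact (Continuous.inv₀ (by fun_prop) fun s => norm_ne_zero_iff.2 (hne s)).intervalIntegrable _ _

lemma mem_convexHull_triple {A B C Q : 𝔼} :
    Q ∈ convexHull ℝ {A, B, C} ↔ ∃ u v w : ℝ, 0 ≤ u ∧ 0 ≤ v ∧ 0 ≤ w ∧ u + v + w = 1 ∧
      Q = u • A + v • B + w • C := by
  constructor
  · intro h
    rw [convexHull_insert (by simp), convexHull_pair] at h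
    obtain ⟨_, rfl, R, ⟨v, w, hv, hw, hvw, rfl⟩, ⟨s, t, hs, ht, hst, rfl⟩⟩ := mem_convexJoin.1 h
    exact ⟨s, t * v, t * w, hs, by positivity, by positivity,
      by rw [add_assoc, ← mul_add, hvw, mul_one, hst],
      by module⟩
  · rintro ⟨u, v, w, hu, hv, hw, h, rfl⟩
    have := (convex_convexHull ℝ {A, B, C}).sum_mem (t := Finset.univ) (w := ![u, v, w])
      (z := ![A, B, C]) (by simp [Fin.forall_fin_succ, *]) (by simp [Fin.sum_univ_three, h])
      (fun i _ => subset_convexHull ℝ _ (by fin_cases i <;> simp))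
    simpa [Fin.sum_univ_three] using this


/-- The affine-polar parametrisation of the triangle with vertices `P`, `P + x`, `P + y`. -/
def triangleMap (P x y : 𝔼) (p : ℝ × ℝ) : ℝ × ℝ :=
  (P 0 + p.1 * (x 0 + p.2 * (y 0 - x 0)), P 1 + p.1 * (x 1 + p.2 * (y 1 - x 1)))

/-- The derivative of `triangleMap`. -/
noncomputable def fderivTriangleMap (x y : 𝔼) (p : ℝ × ℝ) : ℝ × ℝ →L[ℝ] ℝ × ℝ :=
  (Matrix.toLin (.finTwoProd ℝ) (.finTwoProd ℝ)
    !![x 0 + p.2 * (y 0 - x 0), p.1 * (y 0 - x 0);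
      x 1 + p.2 * (y 1 - x 1), p.1 * (y 1 - x 1)]).toContinuousLinearMap

lemma hasFDerivAt_triangleMap (P x y : 𝔼) (p : ℝ × ℝ) :
    HasFDerivAt (triangleMap P x y) (fderivTriangleMap x y p) p := by
  have key : ∀ u v w : ℝ, HasFDerivAt (fun p : ℝ × ℝ => u + p.1 * (v + p.2 * w))
      ((v + p.2 * w) • ContinuousLinearMap.fst ℝ ℝ ℝ + (p.1 * w) • ContinuousLinearMap.snd ℝ ℝ ℝ)
      p := fun u v w => by
    refine ((hasFDerivAt_fst.mul ((hasFDerivAt_snd.mul_const w).const_add v)).const_add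
      u).congr_fderiv ?_
    ext <;> simp [mul_comm]
  rw [fderivTriangleMap, Matrix.toLin_finTwoProd_toContinuousLinearMap]
  exact (key _ _ _).prodMk (key _ _ _)

lemma det_fderivTriangleMap (x y : 𝔼) (p : ℝ × ℝ) :
    (fderivTriangleMap x y p).det = p.1 * cross x y := by
  simp only [fderivTriangleMap, LinearMap.det_toLin,
    Matrix.det_fin_two_of, ContinuousLinearMap.det, cross, LinearMap.coe_toContinuousLinearMap]
  ring

/-- The measurable identification of `ℝ × ℝ` with the Euclidean plane. -/
noncomputable def planeEquiv : ℝ × ℝ ≃ᵐ 𝔼 :=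
  MeasurableEquiv.finTwoArrow.symm.trans (MeasurableEquiv.toLp 2 (Fin 2 → ℝ))

lemma measurePreserving_planeEquiv : MeasurePreserving planeEquiv :=
  ((volume_preserving_finTwoArrow ℝ).symm _).trans
    (EuclideanSpace.volume_preserving_symm_measurableEquiv_toLp (Fin 2)).symm

lemma planeEquiv_triangleMap (P x y : 𝔼) (p : ℝ × ℝ) :
    planeEquiv (triangleMap P x y p) = P + p.1 • (x + p.2 • (y - x)) := by
  ext i
  fin_cases i <;>
    simp [planeEquiv, triangleMap, MeasurableEquiv.finTwoArrow, mul_add]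

lemma injOn_triangleMap (P : 𝔼) {x y : 𝔼} (h : cross x y ≠ 0) :
    InjOn (triangleMap P x y) (Ioc 0 1 ×ˢ Icc 0 1) := by
  rintro ⟨t, s⟩ ⟨ht, -⟩ ⟨t', s'⟩ - heq
  simp only [triangleMap, Prod.mk.injEq, add_right_inj] at heq ht ⊢
  obtain ⟨h0, h1⟩ := heq
  have e1 : t = t' := by
    apply mul_right_cancel₀ h
    rw [cross]
    linear_combination (y 1 - x 1) * h0 - (y 0 - x 0) * h1
  subst e1
  refine ⟨rfl, ?_⟩
  apply mul_left_cancel₀ (mul_ne_zero ht.1.ne' h)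
  rw [cross]
  linear_combination x 0 * h1 - x 1 * h0

lemma preimage_convexHull_sdiff (P : 𝔼) {B C : 𝔼} (h : cross (B - P) (C - P) ≠ 0) :
    planeEquiv ⁻¹' (convexHull ℝ {P, B, C} \ {P}) =
      triangleMap P (B - P) (C - P) '' (Ioc 0 1 ×ˢ Icc 0 1) := by
  have hne : ∀ s : ℝ, (B - P) + s • ((C - P) - (B - P)) ≠ 0 := fun s => by
    have hcr : cross ((B - P) + s • ((C - P) - (B - P))) ((C - P) - (B - P)) ≠ 0 := by
      convert h using 1; simp [cross]; ring
    exact (ne_zero_of_cross_ne_zero hcr).1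
  ext q
  constructor
  · rintro ⟨hq, hqP⟩
    obtain ⟨u, v, w, hu, hv, hw, huvw, hq⟩ := mem_convexHull_triple.1 hq
    have hvw : 0 < v + w := by
      refine (add_nonneg hv hw).lt_of_ne fun h0 => hqP ?_
      obtain rfl : v = 0 := by linarith
      obtain rfl : w = 0 := by linarith
      obtain rfl : u = 1 := by linarith
      simp [hq]
    refine ⟨(v + w, w / (v + w)), ⟨⟨hvw, by linarith⟩, by positivity,
      div_le_one_of_le₀ (by linarith) hvw.le⟩, planeEquiv.injective ?_⟩
    rw [planeEquiv_triangleMap, hq, smul_add, smul_smul, mul_div_cancel₀ _ hvw.ne',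
      show u = 1 - v - w by linarith]
    module
  · rintro ⟨⟨t, s⟩, ⟨⟨ht, ht1⟩, hs, hs1⟩, rfl⟩
    simp only at ht ht1 hs hs1
    simp only [mem_preimage, planeEquiv_triangleMap]
    refine ⟨mem_convexHull_triple.2 ⟨1 - t, t * (1 - s), t * s, by linarith,
      mul_nonneg ht.le (by linarith), by positivity, by ring, by module⟩, ?_⟩
    rw [mem_singleton_iff, add_eq_left]
    exact smul_ne_zero ht.ne' (hne s)

lemma integral_inv_dist_triangle {P B C : 𝔼} (h : cross (B - P) (C - P) ≠ 0) :
    IntegrableOn (fun Q => (dist P Q)⁻¹) (convexHull ℝ {P, B, C}) ∧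
    ∫ Q in convexHull ℝ {P, B, C}, (dist P Q)⁻¹ =
      |cross (B - P) (C - P)| * segmentPotential (dist P B) (dist P C) (dist B C) := by
  set x := B - P with hx
  set y := C - P with hy
  have hne : ∀ s : ℝ, x + s • (y - x) ≠ 0 := fun s => by
    have hcr : cross (x + s • (y - x)) (y - x) ≠ 0 := by
      convert h using 1; simp [cross]; ring
    exact (ne_zero_of_cross_ne_zero hcr).1
  have hae : (convexHull ℝ {P, B, C} \ {P} : Set 𝔼) =ᵐ[volume] convexHull ℝ {P, B, C} :=
    sdiff_null_ae_eq_self (measure_singleton P)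
  have hS : MeasurableSet (Ioc (0 : ℝ) 1 ×ˢ Icc (0 : ℝ) 1) := measurableSet_Ioc.prod measurableSet_Icc
  have hcongr : EqOn (fun p => |(fderivTriangleMap x y p).det| •
      (dist P (planeEquiv (triangleMap P x y p)))⁻¹)
      (fun p => |cross x y| * ‖x + p.2 • (y - x)‖⁻¹) (Ioc (0 : ℝ) 1 ×ˢ Icc (0 : ℝ) 1) := by
    rintro ⟨t, s⟩ ⟨⟨ht, -⟩, -⟩
    simp only at ht
    simp only [det_fderivTriangleMap, planeEquiv_triangleMap, dist_self_add_right, norm_smul,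
      abs_mul, Real.norm_eq_abs, abs_of_pos ht, smul_eq_mul]
    have := norm_ne_zero_iff.2 (hne s)
    field_simp
  have hcont : Continuous fun p : ℝ × ℝ => |cross x y| * ‖x + p.2 • (y - x)‖⁻¹ :=
    continuous_const.mul (Continuous.inv₀ (by fun_prop) fun p => norm_ne_zero_iff.2 (hne p.2))
  constructor
  · rw [← integrableOn_congr_set_ae hae,
      ← measurePreserving_planeEquiv.integrableOn_comp_preimage planeEquiv.measurableEmbedding,
      preimage_convexHull_sdiff P h, integrableOn_image_iff_integrableOn_abs_det_fderiv_smul volume hS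
        (fun p _ => (hasFDerivAt_triangleMap P x y p).hasFDerivWithinAt) (injOn_triangleMap P h)]
    refine IntegrableOn.congr_fun ?_ hcongr.symm hS
    exact (hcont.continuousOn.integrableOn_compact (isCompact_Icc.prod isCompact_Icc)).mono_set
      (prod_mono Ioc_subset_Icc_self Subset.rfl)
  · rw [← setIntegral_congr_set hae,
      ← measurePreserving_planeEquiv.setIntegral_preimage_emb planeEquiv.measurableEmbedding,
      preimage_convexHull_sdiff P h, integral_image_eq_integral_abs_det_fderiv_smul volume hS
        (fun p _ => (hasFDerivAt_triangleMap P x y p).hasFDerivWithinAt) (injOn_triangleMap P h),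
      setIntegral_congr_fun hS hcongr, Measure.volume_eq_prod,
      setIntegral_prod_mul (fun _ => |cross x y|) (fun s : ℝ => ‖x + s • (y - x)‖⁻¹),
      integral_Icc_eq_integral_Ioc,
      ← intervalIntegral.integral_of_le (f := fun s : ℝ => ‖x + s • (y - x)‖⁻¹) zero_le_one,
      integral_inv_norm_segment h, dist_eq_norm' P B, dist_eq_norm' P C, dist_eq_norm' B C]
    simp [hx, hy]

lemma convexHull_triple_eq_union {A B C P : 𝔼} {m n p : ℝ} (hm : 0 < m) (hn : 0 < n) (hp : 0 < p)
    (hmnp : m + n + p = 1) (hP : P = m • A + n • B + p • C) :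
    convexHull ℝ {A, B, C} =
      convexHull ℝ {P, B, C} ∪ convexHull ℝ {P, C, A} ∪ convexHull ℝ {P, A, B} := by
  have cover : ∀ {A B C P Q : 𝔼} {m n p u v w : ℝ}, 0 < m → 0 < n → 0 < p → m + n + p = 1 →
      P = m • A + n • B + p • C → 0 ≤ u → u + v + w = 1 →
      Q = u • A + v • B + w • C → u / m ≤ v / n → u / m ≤ w / p →
      Q ∈ convexHull ℝ {P, B, C} := by
    intro A B C P Q m n p u v w hm hn hp h1 hP hu h2 hQ huv huw
    have e : u = u / m * m := by field_simp
    have ev : v = v / n * n := by field_simp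
    have ew : w = w / p * p := by field_simp
    have f1 := mul_le_mul_of_nonneg_right huv hn.le
    have f2 := mul_le_mul_of_nonneg_right huw hp.le
    refine mem_convexHull_triple.2 ⟨u / m, v - u / m * n, w - u / m * p, by positivity,
      by linarith, by linarith, by linear_combination h2 - (u / m) * h1 - e, ?_⟩
    rw [hQ, hP]
    nth_rewrite 1 [e]
    module
  have sub : ∀ {X Y : 𝔼}, X ∈ convexHull ℝ {A, B, C} → Y ∈ convexHull ℝ {A, B, C} →
      convexHull ℝ {P, X, Y} ⊆ convexHull ℝ {A, B, C} := fun hX hY =>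
    convexHull_min (insert_subset
      (mem_convexHull_triple.2 ⟨m, n, p, hm.le, hn.le, hp.le, hmnp, hP⟩)
      (insert_subset hX (singleton_subset_iff.2 hY))) (convex_convexHull _ _)
  have hA : A ∈ convexHull ℝ {A, B, C} := subset_convexHull ℝ _ (by simp)
  have hB : B ∈ convexHull ℝ {A, B, C} := subset_convexHull ℝ _ (by simp)
  have hC : C ∈ convexHull ℝ {A, B, C} := subset_convexHull ℝ _ (by simp)
  refine Subset.antisymm (fun Q hQ => ?_)
    (union_subset (union_subset (sub hB hC) (sub hC hA)) (sub hA hB))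
  obtain ⟨u, v, w, hu, hv, hw, huvw, hQ⟩ := mem_convexHull_triple.1 hQ
  by_cases h1 : u / m ≤ v / n ∧ u / m ≤ w / p
  · exact Or.inl (Or.inl (cover hm hn hp hmnp hP hu huvw hQ h1.1 h1.2))
  by_cases h2 : v / n ≤ w / p ∧ v / n ≤ u / m
  · exact Or.inl (Or.inr (cover (u := v) (v := w) (w := u) hn hp hm (by linarith)
      (by rw [hP]; abel) hv (by linarith) (by rw [hQ]; abel) h2.1 h2.2))
  · refine Or.inr (cover (u := w) (v := u) (w := v) hp hm hn (by linarith)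
      (by rw [hP]; abel) hw (by linarith) (by rw [hQ]; abel) ?_ ?_) <;> grind

lemma aedisjoint_triangles {P A B C : 𝔼}
    (h : 0 < cross (B - P) (C - P) * cross (C - P) (A - P)) :
    AEDisjoint volume (convexHull ℝ {P, B, C}) (convexHull ℝ {P, C, A}) := by
  refine measure_mono_null (t := line[ℝ, P, C]) ?_ (Measure.addHaar_affineSubspace _ _ fun htop => ?_)
  · rintro Q ⟨hQ, hQ'⟩
    obtain ⟨u, v, w, hu, hv, hw, h1, rfl⟩ := mem_convexHull_triple.1 hQ
    obtain ⟨u', w', v', hu', hw', hv', h1', h2⟩ := mem_convexHull_triple.1 hQ'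
    have h20 := congrArg (fun z : 𝔼 => z 0) h2
    have h21 := congrArg (fun z : 𝔼 => z 1) h2
    simp only [PiLp.add_apply, PiLp.smul_apply, smul_eq_mul] at h20 h21
    have key : v * cross (B - P) (C - P) = - (v' * cross (C - P) (A - P)) := by
      obtain rfl : u = 1 - v - w := by linarith
      obtain rfl : u' = 1 - v' - w' := by linarith
      simp only [cross, PiLp.sub_apply]
      linear_combination (C 1 - P 1) * h20 - (C 0 - P 0) * h21
    have hv0 : v = 0 := by
      by_contra hne
      have hvp := hv.lt_of_ne' hne
      have hc : cross (C - P) (A - P) ≠ 0 := fun h0 => by simp [h0] at h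
      have h3 : v * (cross (B - P) (C - P) * cross (C - P) (A - P)) =
          - (v' * cross (C - P) (A - P) ^ 2) := by linear_combination cross (C - P) (A - P) * key
      nlinarith [mul_pos hvp h, mul_nonneg hv' (sq_nonneg (cross (C - P) (A - P)))]
    subst hv0
    obtain rfl : u = 1 - w := by linarith
    have := AffineMap.lineMap_mem_affineSpan_pair w P C
    rw [AffineMap.lineMap_apply_module] at this
    simpa using this
  · have hB : B ∈ line[ℝ, P, C] := htop ▸ AffineSubspace.mem_top ℝ 𝔼 B
    obtain ⟨r, rfl⟩ := mem_affineSpan_pair_iff_exists_lineMap_eq.1 hB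
    rw [AffineMap.lineMap_apply_module] at h
    apply h.ne'
    simp only [cross, PiLp.sub_apply, PiLp.add_apply, PiLp.smul_apply, smul_eq_mul]
    ring

/-- The contribution of the edge `BC` to the potential at `P`, signed by orientation. -/
noncomputable def edgePotential (B C P : 𝔼) : ℝ :=
  cross (B - P) (C - P) * segmentPotential (dist P B) (dist P C) (dist B C)

lemma cross_eq_of_barycentric {A B C P : 𝔼} {m n p : ℝ} (hmnp : m + n + p = 1)
    (hP : P = m • A + n • B + p • C) :
    cross (B - P) (C - P) = m * cross (B - A) (C - A) ∧
    cross (C - P) (A - P) = n * cross (B - A) (C - A) ∧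
    cross (A - P) (B - P) = p * cross (B - A) (C - A) := by
  obtain rfl : m = 1 - n - p := by linarith
  subst hP
  simp only [cross, PiLp.sub_apply, PiLp.add_apply, PiLp.smul_apply, smul_eq_mul]
  refine ⟨by ring, by ring, by ring⟩

lemma integral_inv_dist_of_barycentric {A B C P : 𝔼} {m n p : ℝ} (hm : 0 < m) (hn : 0 < n)
    (hp : 0 < p) (hmnp : m + n + p = 1) (hP : P = m • A + n • B + p • C)
    (h : cross (B - A) (C - A) ≠ 0) :
    ∫ Q in convexHull ℝ {A, B, C}, (dist P Q)⁻¹ =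
      |cross (B - A) (C - A)| / cross (B - A) (C - A) *
        (edgePotential B C P + edgePotential C A P + edgePotential A B P) := by
  obtain ⟨e1, e2, e3⟩ := cross_eq_of_barycentric hmnp hP
  have hsq : 0 < cross (B - A) (C - A) ^ 2 := by positivity
  have h1 : cross (B - P) (C - P) ≠ 0 := by rw [e1]; exact mul_ne_zero hm.ne' h
  have h2 : cross (C - P) (A - P) ≠ 0 := by rw [e2]; exact mul_ne_zero hn.ne' h
  have h3 : cross (A - P) (B - P) ≠ 0 := by rw [e3]; exact mul_ne_zero hp.ne' h
  have d12 : AEDisjoint volume (convexHull ℝ {P, B, C}) (convexHull ℝ {P, C, A}) :=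
    aedisjoint_triangles (by rw [e1, e2]; linarith [mul_pos (mul_pos hm hn) hsq])
  have d23 : AEDisjoint volume (convexHull ℝ {P, C, A}) (convexHull ℝ {P, A, B}) :=
    aedisjoint_triangles (by rw [e2, e3]; linarith [mul_pos (mul_pos hn hp) hsq])
  have d31 : AEDisjoint volume (convexHull ℝ {P, A, B}) (convexHull ℝ {P, B, C}) :=
    aedisjoint_triangles (by rw [e3, e1]; linarith [mul_pos (mul_pos hp hm) hsq])
  have meas : ∀ X Y : 𝔼, NullMeasurableSet (convexHull ℝ {P, X, Y}) volume := fun X Y =>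
    (convex_convexHull ℝ _).nullMeasurableSet volume
  obtain ⟨i1, v1⟩ := integral_inv_dist_triangle h1
  obtain ⟨i2, v2⟩ := integral_inv_dist_triangle h2
  obtain ⟨i3, v3⟩ := integral_inv_dist_triangle h3
  rw [convexHull_triple_eq_union hm hn hp hmnp hP,
    setIntegral_union₀ (AEDisjoint.union_left_iff.2 ⟨d31.symm, d23⟩) (meas _ _) (i1.union i2) i3,
    setIntegral_union₀ d12 (meas _ _) i1 i2, v1, v2, v3]
  simp only [edgePotential, e1, e2, e3, abs_mul, abs_of_pos hm, abs_of_pos hn, abs_of_pos hp]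
  field_simp

/-- The affine basis formed by the vertices of a nondegenerate triangle. -/
noncomputable def triangleBasis {A B C : 𝔼} (hABC : AffineIndependent ℝ ![A, B, C]) :
    AffineBasis (Fin 3) ℝ 𝔼 :=
  ⟨![A, B, C], hABC, hABC.affineSpan_eq_top_iff_card_eq_finrank_add_one.2 (by simp)⟩

lemma triangleBasis_coord {A B C : 𝔼} (hABC : AffineIndependent ℝ ![A, B, C]) (P : 𝔼) :
    let b := triangleBasis hABC
    b.coord 0 P + b.coord 1 P + b.coord 2 P = 1 ∧
      P = b.coord 0 P • A + b.coord 1 P • B + b.coord 2 P • C := by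
  intro b
  have hs := b.sum_coord_apply_eq_one P
  have hl := b.linear_combination_coord_eq_self P
  rw [Fin.sum_univ_three] at hs hl
  exact ⟨hs, hl.symm⟩

lemma exists_barycentric_of_mem_interior {A B C : 𝔼} (hABC : AffineIndependent ℝ ![A, B, C])
    {P : 𝔼} (hP : P ∈ interior (convexHull ℝ {A, B, C})) :
    ∃ m n p : ℝ, 0 < m ∧ 0 < n ∧ 0 < p ∧ m + n + p = 1 ∧ P = m • A + n • B + p • C := by
  have hr : ({A, B, C} : Set 𝔼) = range (triangleBasis hABC) := by
    change _ = range ![A, B, C]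
    ext
    simp [eq_comm]
    tauto
  rw [hr, (triangleBasis hABC).interior_convexHull] at hP
  exact ⟨_, _, _, hP 0, hP 1, hP 2, triangleBasis_coord hABC P⟩

lemma cross_ne_zero_of_affineIndependent {A B C : 𝔼} (hABC : AffineIndependent ℝ ![A, B, C]) :
    cross (B - A) (C - A) ≠ 0 := by
  intro h0
  have key : ∀ v : 𝔼, cross (B - A) v = 0 := fun v => by
    obtain ⟨h1, h2⟩ := triangleBasis_coord hABC (A + v)
    obtain ⟨-, -, h3⟩ := cross_eq_of_barycentric h1 h2
    rw [h0, mul_zero] at h3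
    simp only [cross, PiLp.sub_apply, PiLp.add_apply] at h3 ⊢
    linarith
  have hAB : A = B := by
    have k0 := key (!₂[0, 1])
    have k1 := key (!₂[1, 0])
    simp [cross] at k0 k1
    ext i
    fin_cases i <;> simp only [Fin.zero_eta, Fin.mk_one] <;> linarith
  exact absurd (hABC.injective (a₁ := 0) (a₂ := 1) hAB) (by decide)


lemma hasDerivAt_edgePotential {B C P : 𝔼} (h : cross (B - P) (C - P) ≠ 0) (v : 𝔼) :
    HasDerivAt (fun t : ℝ => edgePotential B C (P + t • v))
      (cross v (B - C) * segmentPotential (dist P B) (dist P C) (dist B C) +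
        (cross v (C - P) / dist P C - cross v (B - P) / dist P B)) 0 := by
  obtain ⟨hx, hy, hxy⟩ := ne_zero_of_cross_ne_zero h
  have hlt := norm_sub_lt_of_cross_ne_zero h
  have hq := norm_sub_sq_eq (B - P) (C - P)
  have hin := abs_lt.1 (abs_inner_lt_of_cross_ne_zero h)
  have nB := norm_sq_eq (B - P)
  have nC := norm_sq_eq (C - P)
  rw [sub_sub_sub_cancel_right] at hlt hxy hq
  rw [← dist_eq_norm' B C] at hlt hq
  rw [← dist_eq_norm' P B] at hlt hq hin nB
  rw [← dist_eq_norm' P C] at hlt hq hin nC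
  have ha : 0 < dist B C := by rw [dist_eq_norm']; exact norm_pos_iff.2 hxy
  have hr : 0 < dist P B := by rw [dist_eq_norm']; exact norm_pos_iff.2 hx
  have hs : 0 < dist P C := by rw [dist_eq_norm']; exact norm_pos_iff.2 hy
  have hline : HasDerivAt (fun t : ℝ => P + t • v) v 0 := by
    simpa using ((hasDerivAt_id (0 : ℝ)).smul_const v).const_add P
  have hcoord : ∀ i, HasDerivAt (fun t : ℝ => (P + t • v) i) (v i) 0 := fun i => by
    simpa using ((hasDerivAt_id (0 : ℝ)).mul_const (v i)).const_add (P i)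
  have hdist : ∀ X : 𝔼, 0 < dist P X → HasDerivAt (fun t : ℝ => dist (P + t • v) X)
      (-(v 0 * (X - P) 0 + v 1 * (X - P) 1) / dist P X) 0 := fun X hX => by
    have h3 := ((hline.sub_const X).norm_sq).sqrt (by
      simpa [sub_eq_zero] using dist_pos.1 hX)
    simp only [← dist_eq_norm, zero_smul, add_zero, Real.sqrt_sq dist_nonneg] at h3
    refine h3.congr_deriv ?_
    simp only [PiLp.inner_apply, Fin.sum_univ_two, RCLike.inner_apply, conj_trivial,
      PiLp.sub_apply]
    field_simp
    ring
  have hcross : HasDerivAt (fun t : ℝ => cross (B - (P + t • v)) (C - (P + t • v)))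
      (cross v (B - C)) 0 := by
    have h3 := (((hcoord 0).const_sub (B 0)).mul ((hcoord 1).const_sub (C 1))).sub
      (((hcoord 1).const_sub (B 1)).mul ((hcoord 0).const_sub (C 0)))
    refine h3.congr_deriv ?_
    simp only [zero_smul, add_zero, cross, PiLp.sub_apply]
    ring
  have hsum := (hdist B hr).add (hdist C hs)
  have e0 : dist (P + (0 : ℝ) • v) B + dist (P + (0 : ℝ) • v) C = dist P B + dist P C := by simp
  have hseg := (((hsum.add_const (dist B C)).log (by
    change dist (P + (0 : ℝ) • v) B + dist (P + (0 : ℝ) • v) C + dist B C ≠ 0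
    rw [e0]; positivity)).sub ((hsum.sub_const (dist B C)).log (by
    change dist (P + (0 : ℝ) • v) B + dist (P + (0 : ℝ) • v) C - dist B C ≠ 0
    rw [e0]; linarith))).div_const (dist B C)
  refine (hcross.mul hseg).congr_deriv ?_
  simp only [zero_smul, add_zero, Pi.add_apply, segmentPotential, Pi.sub_apply]
  congr 1
  have hD : (dist P B + dist P C + dist B C) * (dist P B + dist P C - dist B C) =
      2 * (dist P B * dist P C + ((B - P) 0 * (C - P) 0 + (B - P) 1 * (C - P) 1)) := by
    linear_combination -hq
  have hD0 : dist P B * dist P C + ((B - P) 0 * (C - P) 0 + (B - P) 1 * (C - P) 1) ≠ 0 := by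
    linarith
  have h1 : dist P B + dist P C + dist B C ≠ 0 := by positivity
  have h2 : dist P B + dist P C - dist B C ≠ 0 := by linarith
  have hv : cross (B - P) (C - P) *
      ((v 0 * (B - P) 0 + v 1 * (B - P) 1) * dist P C +
        (v 0 * (C - P) 0 + v 1 * (C - P) 1) * dist P B) =
      (cross v (C - P) * dist P B - cross v (B - P) * dist P C) *
        (dist P B * dist P C + ((B - P) 0 * (C - P) 0 + (B - P) 1 * (C - P) 1)) := by
    unfold cross
    linear_combination (-(v 0 * (C - P) 1 - v 1 * (C - P) 0) * dist P C) * nB +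
      ((v 0 * (B - P) 1 - v 1 * (B - P) 0) * dist P B) * nC
  rw [div_sub_div _ _ h1 h2, hD]
  field_simp
  linear_combination 2 * dist B C * hv

lemma differentiableAt_edgePotential {B C P : 𝔼} (h : cross (B - P) (C - P) ≠ 0) :
    DifferentiableAt ℝ (edgePotential B C) P := by
  obtain ⟨hx, hy, hxy⟩ := ne_zero_of_cross_ne_zero h
  have hlt := norm_sub_lt_of_cross_ne_zero h
  rw [sub_sub_sub_cancel_right, ← dist_eq_norm', ← dist_eq_norm', ← dist_eq_norm'] at hlt
  have hr : DifferentiableAt ℝ (fun Q : 𝔼 => dist Q B) P :=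
    differentiableAt_id.dist ℝ (differentiableAt_const B) (sub_ne_zero.1 hx).symm
  have hs : DifferentiableAt ℝ (fun Q : 𝔼 => dist Q C) P :=
    differentiableAt_id.dist ℝ (differentiableAt_const C) (sub_ne_zero.1 hy).symm
  have hcross : DifferentiableAt ℝ (fun Q : 𝔼 => cross (B - Q) (C - Q)) P := by
    simp only [cross, PiLp.sub_apply]
    fun_prop
  have ha := dist_nonneg (x := B) (y := C)
  have h1 : dist P B + dist P C + dist B C ≠ 0 := by linarith
  have h2 : dist P B + dist P C - dist B C ≠ 0 := by linarith
  have hrs : DifferentiableAt ℝ (fun Q : 𝔼 => dist Q B + dist Q C) P := hr.add hs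
  have := hcross.mul
    ((((hrs.add_const _).log h1).sub ((hrs.sub_const _).log h2)).mul_const (dist B C)⁻¹)
  refine this.congr_of_eventuallyEq (.of_forall fun Q => ?_)
  simp only [edgePotential, segmentPotential, div_eq_mul_inv, Pi.mul_apply, Pi.sub_apply]

lemma segmentPotential_pos {r s a : ℝ} (ha : 0 < a) (h : a < r + s) :
    0 < segmentPotential r s a :=
  div_pos (sub_pos.2 (Real.log_lt_log (by linarith) (by linarith))) ha

lemma mul_cosh_div_sinh_segmentPotential {r s a : ℝ} (ha : 0 < a) (h : a < r + s) :
    a * (Real.cosh (a * segmentPotential r s a / 2) / Real.sinh (a * segmentPotential r s a / 2)) =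
      r + s := by
  have hk := segmentPotential_pos ha h
  have hsinh := Real.sinh_pos_iff.2 (by positivity : 0 < a * segmentPotential r s a / 2)
  rw [mul_div_assoc', div_eq_iff hsinh.ne']
  have hexp : Real.exp (a * segmentPotential r s a / 2) ^ 2 * (r + s - a) = r + s + a := by
    rw [← Real.exp_nat_mul, segmentPotential]
    push_cast
    rw [mul_div_cancel₀ _ two_ne_zero, mul_div_cancel₀ _ ha.ne', Real.exp_sub,
      Real.exp_log (by linarith), Real.exp_log (by linarith), div_mul_cancel₀ _ (by linarith)]
  rw [Real.cosh_eq, Real.sinh_eq, Real.exp_neg]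
  have := Real.exp_pos (a * segmentPotential r s a / 2)
  field_simp
  linear_combination -hexp

end TrianglePotential

open TrianglePotential in
theorem stationary_point_coth_distances
    (A B C : EuclideanSpace ℝ (Fin 2))
    (hABC : AffineIndependent ℝ ![A, B, C])
    (T : Set (EuclideanSpace ℝ (Fin 2)))
    (hT : T = convexHull ℝ {A, B, C})
    (V : EuclideanSpace ℝ (Fin 2) → ℝ)
    (hV : ∀ P, V P = ∫ Q in T, (dist P Q)⁻¹ ∂volume)
    (P : EuclideanSpace ℝ (Fin 2)) (hP : P ∈ interior T)
    (hgrad : gradient V P = 0)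
    (a b c : ℝ) (ha : a = dist B C) (hb : b = dist C A) (hc : c = dist A B)
    (coth : ℝ → ℝ) (hcoth : ∀ x, coth x = Real.cosh x / Real.sinh x) :
    ∃ lam : ℝ, 0 < lam ∧
      dist P A = (b * coth (b * lam / (a + b + c)) + c * coth (c * lam / (a + b + c))
          - a * coth (a * lam / (a + b + c))) / 2 ∧
      dist P B = (c * coth (c * lam / (a + b + c)) + a * coth (a * lam / (a + b + c))
          - b * coth (b * lam / (a + b + c))) / 2 ∧
      dist P C = (a * coth (a * lam / (a + b + c)) + b * coth (b * lam / (a + b + c))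
          - c * coth (c * lam / (a + b + c))) / 2 := by
  subst hT
  have hΔ := cross_ne_zero_of_affineIndependent hABC
  set κ := |cross (B - A) (C - A)| / cross (B - A) (C - A)
  have hκ : κ ≠ 0 := div_ne_zero (abs_ne_zero.2 hΔ) hΔ
  have hVeq : V =ᶠ[nhds P] fun Q =>
      κ * (edgePotential B C Q + edgePotential C A Q + edgePotential A B Q) := by
    filter_upwards [isOpen_interior.mem_nhds hP] with Q hQ
    obtain ⟨m, n, p, hm, hn, hp, hmnp, hQ⟩ := exists_barycentric_of_mem_interior hABC hQ
    rw [hV, integral_inv_dist_of_barycentric hm hn hp hmnp hQ hΔ]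
  obtain ⟨m, n, p, hm, hn, hp, hmnp, hPb⟩ := exists_barycentric_of_mem_interior hABC hP
  obtain ⟨e1, e2, e3⟩ := cross_eq_of_barycentric hmnp hPb
  have h1 : cross (B - P) (C - P) ≠ 0 := by rw [e1]; exact mul_ne_zero hm.ne' hΔ
  have h2 : cross (C - P) (A - P) ≠ 0 := by rw [e2]; exact mul_ne_zero hn.ne' hΔ
  have h3 : cross (A - P) (B - P) ≠ 0 := by rw [e3]; exact mul_ne_zero hp.ne' hΔ
  have hdiff : DifferentiableAt ℝ V P :=
    ((((differentiableAt_edgePotential h1).add (differentiableAt_edgePotential h2)).add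
      (differentiableAt_edgePotential h3)).const_mul κ).congr_of_eventuallyEq hVeq
  have hfd : HasFDerivAt V (0 : EuclideanSpace ℝ (Fin 2) →L[ℝ] ℝ) P := by
    have := hdiff.hasGradientAt.hasFDerivAt
    rwa [hgrad, map_zero] at this
  set ka := segmentPotential (dist P B) (dist P C) (dist B C)
  set kb := segmentPotential (dist P C) (dist P A) (dist C A)
  set kc := segmentPotential (dist P A) (dist P B) (dist A B)
  have hbal : ∀ v, cross v (B - C) * ka + cross v (C - A) * kb + cross v (A - B) * kc = 0 := by
    intro v
    have hP0 : HasFDerivAt (fun Q =>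
        κ * (edgePotential B C Q + edgePotential C A Q + edgePotential A B Q))
        (0 : EuclideanSpace ℝ (Fin 2) →L[ℝ] ℝ) (P + (0 : ℝ) • v) := by
      simpa using hfd.congr_of_eventuallyEq hVeq.symm
    have hline : HasDerivAt (fun t : ℝ => P + t • v) v 0 := by
      simpa using ((hasDerivAt_id (0 : ℝ)).smul_const v).const_add P
    have hd := (((hasDerivAt_edgePotential h1 v).add (hasDerivAt_edgePotential h2 v)).add
      (hasDerivAt_edgePotential h3 v)).const_mul κ
    have hd0 := hP0.comp_hasDerivAt (0 : ℝ) hline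
    have := hd.unique hd0
    have := (mul_eq_zero.1 this).resolve_left hκ
    linear_combination this
  have hac : ka = kc := by
    have := hbal (C - A)
    apply mul_right_cancel₀ hΔ
    simp only [cross, PiLp.sub_apply] at this ⊢
    linear_combination -this
  have hbc : kb = kc := by
    have := hbal (B - C)
    apply mul_right_cancel₀ hΔ
    simp only [cross, PiLp.sub_apply] at this ⊢
    linear_combination this
  have side : ∀ {X Y : EuclideanSpace ℝ (Fin 2)}, cross (X - P) (Y - P) ≠ 0 →
      0 < dist X Y ∧ dist X Y < dist P X + dist P Y := fun {X Y} h => by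
    have hlt := norm_sub_lt_of_cross_ne_zero h
    rw [sub_sub_sub_cancel_right, ← dist_eq_norm', ← dist_eq_norm', ← dist_eq_norm'] at hlt
    refine ⟨dist_pos.2 ?_, hlt⟩
    rintro rfl
    exact (ne_zero_of_cross_ne_zero h).2.2 (sub_self _)
  obtain ⟨pa, la⟩ := side h1
  obtain ⟨pb, lb⟩ := side h2
  obtain ⟨pc, lc⟩ := side h3
  have hk : 0 < kc := segmentPotential_pos pc lc
  have ua : dist B C * (Real.cosh (dist B C * ka / 2) / Real.sinh (dist B C * ka / 2)) = _ :=
    mul_cosh_div_sinh_segmentPotential pa la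
  have ub : dist C A * (Real.cosh (dist C A * kb / 2) / Real.sinh (dist C A * kb / 2)) = _ :=
    mul_cosh_div_sinh_segmentPotential pb lb
  have uc : dist A B * (Real.cosh (dist A B * kc / 2) / Real.sinh (dist A B * kc / 2)) = _ :=
    mul_cosh_div_sinh_segmentPotential pc lc
  rw [hac, ← ha] at ua
  rw [hbc, ← hb] at ub
  rw [← hc] at uc
  have hsum : 0 < a + b + c := by rw [ha, hb, hc]; positivity
  have harg : ∀ x, x * (kc * (a + b + c) / 2) / (a + b + c) = x * kc / 2 := fun x => by
    field_simp
  refine ⟨kc * (a + b + c) / 2, by positivity, ?_⟩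
  simp only [harg, hcoth, ua, ub, uc]
  refine ⟨by ring, by ring, by ring⟩
end

section
/- Hyperbolic cotangent difference bounds: for all real numbers b, c, t with 0 < c < b and t > 0, one has 0 < b · coth(b·t) − c · coth(c·t) < b − c, where coth x = cosh x / sinh x. -/
open Real Set in
/-- The derivative of `x * coth x` away from the origin. -/
theorem hasDerivAt_mul_coth {x : ℝ} (hx : x ≠ 0) :
    HasDerivAt (fun y : ℝ => y * (cosh y / sinh y))
      ((sinh x * cosh x - x) / sinh x ^ 2) x := by
  have hs : sinh x ≠ 0 := sinh_ne_zero.2 hx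
  refine ((hasDerivAt_id' x).mul ((hasDerivAt_cosh x).div (hasDerivAt_sinh x) hs)).congr_deriv ?_
  simp only [Pi.div_apply]
  field_simp
  linear_combination -x * cosh_sq x

open Real Set in
theorem strictMonoOn_mul_coth :
    StrictMonoOn (fun y : ℝ => y * (cosh y / sinh y)) (Ioi 0) := by
  refine strictMonoOn_of_hasDerivWithinAt_pos (convex_Ioi 0)
    (fun x hx => (hasDerivAt_mul_coth (ne_of_gt hx)).continuousAt.continuousWithinAt)
    (fun x hx => (hasDerivAt_mul_coth (ne_of_gt (interior_subset hx))).hasDerivWithinAt) ?_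
  intro x hx
  have hx : 0 < x := interior_subset hx
  have hs : 0 < sinh x := sinh_pos_iff.2 hx
  refine div_pos ?_ (pow_pos hs 2)
  nlinarith [self_lt_sinh_iff.2 hx, one_le_cosh x]

open Real Set in
theorem strictAntiOn_mul_coth_sub_self :
    StrictAntiOn (fun y : ℝ => y * (cosh y / sinh y) - y) (Ioi 0) := by
  have hd {x : ℝ} (hx : 0 < x) := (hasDerivAt_mul_coth hx.ne').sub (hasDerivAt_id' x)
  refine strictAntiOn_of_hasDerivWithinAt_neg (convex_Ioi 0)
    (fun x hx => (hd hx).continuousAt.continuousWithinAt)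
    (fun x hx => (hd (interior_subset hx)).hasDerivWithinAt) ?_
  intro x hx
  have hx : 0 < x := interior_subset hx
  have hs : 0 < sinh x := sinh_pos_iff.2 hx
  rw [sub_neg, div_lt_one (pow_pos hs 2)]
  have hexp : 1 - 2 * x < exp (-x) * exp (-x) := by
    rw [← exp_add]
    linarith [add_one_lt_exp (show -x + -x ≠ 0 by linarith)]
  have hmul : exp x * exp (-x) = 1 := by rw [← exp_add, add_neg_cancel, exp_zero]
  have hsinh : sinh x * exp (-x) < x := by
    rw [sinh_eq]
    linarith
  rw [← cosh_sub_sinh] at hsinh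
  linarith

theorem coth_difference_bounds
    (coth : ℝ → ℝ) (hcoth : ∀ x, coth x = Real.cosh x / Real.sinh x)
    (b c t : ℝ) (hc : 0 < c) (hcb : c < b) (ht : 0 < t) :
    0 < b * coth (b * t) - c * coth (c * t) ∧
    b * coth (b * t) - c * coth (c * t) < b - c := by
  have hct : 0 < c * t := mul_pos hc ht
  have hbt : 0 < b * t := mul_pos (hc.trans hcb) ht
  have hlt : c * t < b * t := mul_lt_mul_of_pos_right hcb ht
  have hmono := strictMonoOn_mul_coth hct hbt hlt
  have hanti := strictAntiOn_mul_coth_sub_self hct hbt hlt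
  simp only [← hcoth] at hmono hanti
  constructor
  · refine pos_of_mul_pos_left (b := t) ?_ ht.le
    linarith
  · refine lt_of_mul_lt_mul_right ?_ ht.le
    linarith
end

section
/- Strict monotonicity of the defining equation: let a, b, c be positive real numbers satisfying the strict triangle inequalities a < b + c, b < c + a, c < a + b. For λ > 0 set u(λ) = a · coth(a·λ/(a+b+c)), v(λ) = b · coth(b·λ/(a+b+c)), w(λ) = c · coth(c·λ/(a+b+c)), and define F(λ) = Real.sqrt((u(λ)² − a²)·(a² − (v(λ) − w(λ))²)) + Real.sqrt((v(λ)² − b²)·(b² − (w(λ) − u(λ))²)) + Real.sqrt((w(λ)² − c²)·(c² − (u(λ) − v(λ))²)). Then F is strictly decreasing on the interval (0, ∞) (StrictAntiOn F (Set.Ioi 0)). -/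
/-- The function `s ↦ p * coth (p * s)`. -/
noncomputable def scaledCoth (p s : ℝ) : ℝ := p * (Real.cosh (p * s) / Real.sinh (p * s))

lemma nonneg_of_hasDerivAt_nonneg {f f' : ℝ → ℝ} (hf : ∀ x, HasDerivAt f (f' x) x)
    (h0 : f 0 = 0) (h' : ∀ x, 0 < x → 0 ≤ f' x) {x : ℝ} (hx : 0 ≤ x) : 0 ≤ f x := by
  have hm : MonotoneOn f (Set.Ici 0) := by
    refine monotoneOn_of_deriv_nonneg (convex_Ici 0)
      (fun y _ => (hf y).continuousAt.continuousWithinAt)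
      (fun y _ => (hf y).differentiableAt.differentiableWithinAt) fun y hy => ?_
    rw [interior_Ici] at hy
    rw [(hf y).deriv]
    exact h' y hy
  rw [← h0]
  exact hm Set.self_mem_Ici hx hx

lemma hasDerivAt_sinh_const_mul (p x : ℝ) :
    HasDerivAt (fun x => Real.sinh (p * x)) (p * Real.cosh (p * x)) x := by
  simpa [mul_comm] using ((hasDerivAt_id x).const_mul p).sinh

lemma hasDerivAt_cosh_const_mul (p x : ℝ) :
    HasDerivAt (fun x => Real.cosh (p * x)) (p * Real.sinh (p * x)) x := by
  simpa [mul_comm] using ((hasDerivAt_id x).const_mul p).cosh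

lemma mul_sinh_le_mul_sinh {p q s : ℝ} (hq : 0 < q) (hqp : q ≤ p) (hs : 0 ≤ s) :
    p * Real.sinh (q * s) ≤ q * Real.sinh (p * s) := by
  have h := nonneg_of_hasDerivAt_nonneg
    (fun x => ((hasDerivAt_sinh_const_mul p x).const_mul q).sub
      ((hasDerivAt_sinh_const_mul q x).const_mul p)) (by simp) (fun x hx => ?_) hs
  · simpa using h
  · have h1 : Real.cosh (q * x) ≤ Real.cosh (p * x) := by
      rw [Real.cosh_le_cosh, abs_of_nonneg (by positivity),
        abs_of_nonneg (mul_nonneg (hq.le.trans hqp) hx.le)]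
      gcongr
    have h2 := mul_le_mul_of_nonneg_left h1 (mul_nonneg hq.le (hq.le.trans hqp))
    linarith

lemma scaledCoth_le_scaledCoth {p q s : ℝ} (hq : 0 < q) (hqp : q ≤ p) (hs : 0 < s) :
    scaledCoth q s ≤ scaledCoth p s := by
  have hp := hq.trans_le hqp
  have h := nonneg_of_hasDerivAt_nonneg
    (fun x => (((hasDerivAt_cosh_const_mul p x).mul (hasDerivAt_sinh_const_mul q x)).const_mul
      p).sub (((hasDerivAt_cosh_const_mul q x).mul (hasDerivAt_sinh_const_mul p x)).const_mul q))
    (by simp) (fun x hx => ?_) hs.le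
  · have hS : 0 < Real.sinh (p * s) := Real.sinh_pos_iff.2 (by positivity)
    have hT : 0 < Real.sinh (q * s) := Real.sinh_pos_iff.2 (by positivity)
    simp only [Pi.sub_apply, Pi.mul_apply] at h
    rw [scaledCoth, scaledCoth, ← mul_div_assoc, ← mul_div_assoc, div_le_div_iff₀ hT hS]
    linarith
  · have hS : 0 < Real.sinh (p * x) := Real.sinh_pos_iff.2 (by positivity)
    have hT : 0 < Real.sinh (q * x) := Real.sinh_pos_iff.2 (by positivity)
    have h2 : 0 ≤ (p - q) * (p + q) * (Real.sinh (p * x) * Real.sinh (q * x)) :=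
      mul_nonneg (mul_nonneg (sub_nonneg.2 hqp) (by positivity)) (by positivity)
    linarith

lemma scaledCoth_sub_le {p q s : ℝ} (hq : 0 < q) (hqp : q ≤ p) (hs : 0 < s) :
    scaledCoth p s - scaledCoth q s ≤ p - q := by
  have hp := hq.trans_le hqp
  have hS : 0 < Real.sinh (p * s) := Real.sinh_pos_iff.2 (by positivity)
  have hT : 0 < Real.sinh (q * s) := Real.sinh_pos_iff.2 (by positivity)
  have h1 : Real.exp (-(p * s)) ≤ Real.exp (-(q * s)) := by gcongr
  have h2 := mul_le_mul h1 (mul_sinh_le_mul_sinh hq hqp hs.le) (by positivity) (by positivity)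
  rw [← Real.cosh_sub_sinh, ← Real.cosh_sub_sinh] at h2
  have h3 : p * (Real.cosh (p * s) - Real.sinh (p * s)) / Real.sinh (p * s) ≤
      q * (Real.cosh (q * s) - Real.sinh (q * s)) / Real.sinh (q * s) := by
    rw [div_le_div_iff₀ hS hT]
    linarith
  rw [mul_div_assoc, mul_div_assoc, sub_div, sub_div, div_self hS.ne', div_self hT.ne'] at h3
  simp only [scaledCoth]
  linarith

lemma scaledCoth_sq_sub {p s : ℝ} (hp : 0 < p) (hs : 0 < s) :
    scaledCoth p s ^ 2 - p ^ 2 = (p / Real.sinh (p * s)) ^ 2 := by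
  have hS : 0 < Real.sinh (p * s) := Real.sinh_pos_iff.2 (by positivity)
  rw [scaledCoth]
  field_simp
  linarith [Real.cosh_sq (p * s)]

lemma hasDerivAt_scaledCoth {p s : ℝ} (hp : 0 < p) (hs : 0 < s) :
    HasDerivAt (scaledCoth p) (-(p / Real.sinh (p * s)) ^ 2) s := by
  have hS : 0 < Real.sinh (p * s) := Real.sinh_pos_iff.2 (by positivity)
  refine (((hasDerivAt_cosh_const_mul p s).div (hasDerivAt_sinh_const_mul p s)
    hS.ne').const_mul p).congr_deriv ?_
  field_simp
  linear_combination -Real.cosh_sq (p * s)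

lemma monotoneOn_scaledCoth_sub {p q : ℝ} (hq : 0 < q) (hqp : q ≤ p) :
    MonotoneOn (scaledCoth p - scaledCoth q) (Set.Ioi 0) := by
  have hp := hq.trans_le hqp
  have hd : ∀ s, 0 < s → HasDerivAt (scaledCoth p - scaledCoth q) _ s := fun s hs =>
    (hasDerivAt_scaledCoth hp hs).sub (hasDerivAt_scaledCoth hq hs)
  refine monotoneOn_of_deriv_nonneg (convex_Ioi 0)
    (fun s hs => (hd s hs).continuousAt.continuousWithinAt)
    (fun s hs => (hd s (interior_subset hs)).differentiableAt.differentiableWithinAt)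
    fun s hs => ?_
  rw [interior_Ioi, Set.mem_Ioi] at hs
  have hS : 0 < Real.sinh (p * s) := Real.sinh_pos_iff.2 (by positivity)
  have hT : 0 < Real.sinh (q * s) := Real.sinh_pos_iff.2 (by positivity)
  have h : p / Real.sinh (p * s) ≤ q / Real.sinh (q * s) := by
    rw [div_le_div_iff₀ hS hT]
    exact mul_sinh_le_mul_sinh hq hqp hs.le
  have h2 := pow_le_pow_left₀ (by positivity) h 2
  rw [(hd s hs).deriv]
  linarith

lemma scaledCoth_sub_sq_le {p q s t : ℝ} (hp : 0 < p) (hq : 0 < q) (hs : 0 < s) (hst : s ≤ t) :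
    (scaledCoth p s - scaledCoth q s) ^ 2 ≤ (scaledCoth p t - scaledCoth q t) ^ 2 ∧
      (scaledCoth p t - scaledCoth q t) ^ 2 ≤ (p - q) ^ 2 := by
  wlog hqp : q ≤ p generalizing p q
  · have h := this hq hp (le_of_not_ge hqp)
    rwa [sub_sq_comm (scaledCoth q s), sub_sq_comm (scaledCoth q t), sub_sq_comm q] at h
  have ht := hs.trans_le hst
  exact ⟨pow_le_pow_left₀ (sub_nonneg.2 (scaledCoth_le_scaledCoth hq hqp hs))
      (monotoneOn_scaledCoth_sub hq hqp hs ht hst) 2,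
    pow_le_pow_left₀ (sub_nonneg.2 (scaledCoth_le_scaledCoth hq hqp ht))
      (scaledCoth_sub_le hq hqp ht) 2⟩

lemma sqrt_scaledCoth_lt {p q r s t : ℝ} (hp : 0 < p) (hq : 0 < q) (hr : 0 < r)
    (h₁ : q < r + p) (h₂ : r < p + q) (hs : 0 < s) (hst : s < t) :
    Real.sqrt ((scaledCoth p t ^ 2 - p ^ 2) * (p ^ 2 - (scaledCoth q t - scaledCoth r t) ^ 2)) <
      Real.sqrt
        ((scaledCoth p s ^ 2 - p ^ 2) * (p ^ 2 - (scaledCoth q s - scaledCoth r s) ^ 2)) := by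
  have ht := hs.trans hst
  obtain ⟨h3, h4⟩ := scaledCoth_sub_sq_le hq hr hs hst.le
  have h5 : (q - r) ^ 2 < p ^ 2 := sq_lt_sq' (by linarith) (by linarith)
  have hS : 0 < Real.sinh (p * s) := Real.sinh_pos_iff.2 (by positivity)
  have hT : 0 < Real.sinh (p * t) := Real.sinh_pos_iff.2 (by positivity)
  have h6 : Real.sinh (p * s) < Real.sinh (p * t) :=
    Real.sinh_lt_sinh.2 (mul_lt_mul_of_pos_left hst hp)
  have h7 : (p / Real.sinh (p * t)) ^ 2 < (p / Real.sinh (p * s)) ^ 2 := by gcongr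
  rw [scaledCoth_sq_sub hp hs, scaledCoth_sq_sub hp ht]
  refine Real.sqrt_lt_sqrt (mul_nonneg (by positivity) (by linarith)) ?_
  exact mul_lt_mul h7 (by linarith) (by linarith) (by positivity)


theorem F_strict_anti
    (a b c : ℝ) (ha : 0 < a) (hb : 0 < b) (hc : 0 < c)
    (hta : a < b + c) (htb : b < c + a) (htc : c < a + b)
    (coth : ℝ → ℝ) (hcoth : ∀ x, coth x = Real.cosh x / Real.sinh x)
    (u v w F : ℝ → ℝ)
    (hu : ∀ lam, u lam = a * coth (a * lam / (a + b + c)))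
    (hv : ∀ lam, v lam = b * coth (b * lam / (a + b + c)))
    (hw : ∀ lam, w lam = c * coth (c * lam / (a + b + c)))
    (hF : ∀ lam, F lam =
      Real.sqrt ((u lam ^ 2 - a ^ 2) * (a ^ 2 - (v lam - w lam) ^ 2))
      + Real.sqrt ((v lam ^ 2 - b ^ 2) * (b ^ 2 - (w lam - u lam) ^ 2))
      + Real.sqrt ((w lam ^ 2 - c ^ 2) * (c ^ 2 - (u lam - v lam) ^ 2))) :
    StrictAntiOn F (Set.Ioi 0) := by
  have hpos : 0 < a + b + c := by positivity
  have hu' : ∀ x, u x = scaledCoth a (x / (a + b + c)) := fun x => by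
    rw [hu, hcoth, scaledCoth, mul_div_assoc]
  have hv' : ∀ x, v x = scaledCoth b (x / (a + b + c)) := fun x => by
    rw [hv, hcoth, scaledCoth, mul_div_assoc]
  have hw' : ∀ x, w x = scaledCoth c (x / (a + b + c)) := fun x => by
    rw [hw, hcoth, scaledCoth, mul_div_assoc]
  intro x hx y _ hxy
  have hs : 0 < x / (a + b + c) := div_pos hx hpos
  have hst : x / (a + b + c) < y / (a + b + c) := div_lt_div_of_pos_right hxy hpos
  simp only [hF, hu', hv', hw']
  exact add_lt_add (add_lt_add (sqrt_scaledCoth_lt ha hb hc htb htc hs hst)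
    (sqrt_scaledCoth_lt hb hc ha htc hta hs hst)) (sqrt_scaledCoth_lt hc ha hb hta htb hs hst)
end
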